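/- arXiv:math/0503720 — 2 statements merged into one kernel-verified Lean document; each statement's English description precedes it below -/
import Mathlib

section
/- For every λ₀ ∈ Λ and every ε > 0 there exists λ ∈ Λ with |λ − λ₀| ≤ ε such that the map Q_λ has a wandering disc contained in its filled Julia set K(Q_λ, B) which is not attracted to an attracting cycle: there exists a closed ball D ⊆ B such that (1) Q_λ^n(D) ⊆ B for all n ≥ 0; (2) the images Q_λ^n(D), n ≥ 0, are pairwise disjoint; and (3) for every k ≥ 1 and every periodic point z₀ ∈ B with Q_λ^k(z₀) = z₀ and |(Q_λ^k)'(z₀)| < 1, no point x ∈ D satisfies min_{0≤j<k} |Q_λ^n(x) − Q_λ^j(z₀)| → 0 as n → ∞. -/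
open Filter Metric

/-- The polynomial family `P_λ(z) = (λ/p)·z^p + (1 − λ/p)·z^{p+1}`. -/
noncomputable def Pfam {K : Type*} [NontriviallyNormedField K] (p : ℕ) (lam z : K) : K :=
  lam / (p : K) * z ^ p + (1 - lam / (p : K)) * z ^ (p + 1)

/-- Evaluation at `z` of the power series with coefficients `a`. -/
noncomputable def Qser {K : Type*} [NontriviallyNormedField K] (a : ℕ → K) (z : K) : K :=
  ∑' i, a i * z ^ i

/-- The perturbed map `Q*_λ = P_λ + Q`. -/
noncomputable def Qstar {K : Type*} [NontriviallyNormedField K] (p : ℕ) (a : ℕ → K)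
    (lam z : K) : K :=
  Pfam p lam z + Qser a z

/-- The conjugated map `Q_λ(z) = Q*_λ(z + h(λ) − 1) − h(λ) + 1`, where `h λ` is the
fixed point of `Q*_λ` near `1` given by Hensel's lemma. -/
noncomputable def Qconj {K : Type*} [NontriviallyNormedField K] (p : ℕ) (a : ℕ → K)
    (h : K → K) (lam z : K) : K :=
  Qstar p a lam (z + h lam - 1) - h lam + 1

section Ultrametric

variable {K : Type*} [NontriviallyNormedField K] [IsUltrametricDist K]

theorem norm_add_le_of_le_of_le {x y : K} {b : ℝ} (hx : ‖x‖ ≤ b) (hy : ‖y‖ ≤ b) :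
    ‖x + y‖ ≤ b :=
  (IsUltrametricDist.norm_add_le_max x y).trans (max_le hx hy)

theorem norm_sub_le_of_le_of_le {x y : K} {b : ℝ} (hx : ‖x‖ ≤ b) (hy : ‖y‖ ≤ b) :
    ‖x - y‖ ≤ b := by
  rw [sub_eq_add_neg]
  exact norm_add_le_of_le_of_le hx (by rwa [norm_neg])

theorem norm_add_lt_of_lt_of_lt {x y : K} {b : ℝ} (hx : ‖x‖ < b) (hy : ‖y‖ < b) :
    ‖x + y‖ < b :=
  (IsUltrametricDist.norm_add_le_max x y).trans_lt (max_lt hx hy)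

theorem norm_sub_lt_of_lt_of_lt {x y : K} {b : ℝ} (hx : ‖x‖ < b) (hy : ‖y‖ < b) :
    ‖x - y‖ < b := by
  rw [sub_eq_add_neg]
  exact norm_add_lt_of_lt_of_lt hx (by rwa [norm_neg])

theorem norm_add_eq_left_of_lt {x y : K} (h : ‖y‖ < ‖x‖) : ‖x + y‖ = ‖x‖ := by
  rw [IsUltrametricDist.norm_add_eq_max_of_norm_ne_norm h.ne', max_eq_left h.le]

theorem norm_eq_of_norm_sub_lt_left {x y : K} (h : ‖x - y‖ < ‖y‖) : ‖x‖ = ‖y‖ := by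
  have := norm_add_eq_left_of_lt h
  simpa using this

theorem norm_eq_one_of_norm_sub_one_lt {x : K} (h : ‖x - 1‖ < 1) : ‖x‖ = 1 := by
  have := norm_eq_of_norm_sub_lt_left (x := x) (y := 1) (by simpa using h)
  simpa using this

/-- On the closed unit ball, `z ↦ z ^ n` is `1`-Lipschitz. -/
theorem norm_pow_sub_pow_le {x y : K} (hx : ‖x‖ ≤ 1) (hy : ‖y‖ ≤ 1) (n : ℕ) :
    ‖x ^ n - y ^ n‖ ≤ ‖x - y‖ := by
  rw [← (Commute.all x y).geom_sum₂_mul, norm_mul]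
  refine mul_le_of_le_one_left (norm_nonneg _) ?_
  refine IsUltrametricDist.norm_sum_le_of_forall_le_of_nonneg zero_le_one fun i _ => ?_
  rw [norm_mul, norm_pow, norm_pow]
  exact mul_le_one₀ (pow_le_one₀ (norm_nonneg _) hx) (by positivity)
    (pow_le_one₀ (norm_nonneg _) hy)

theorem norm_pow_succ_sub_pow_succ_le {x y : K} {s : ℝ} (hx : ‖x‖ ≤ s)
    (hy : ‖y‖ ≤ s) (n : ℕ) : ‖x ^ (n + 1) - y ^ (n + 1)‖ ≤ s ^ n * ‖x - y‖ := by
  have hs0 : 0 ≤ s := (norm_nonneg _).trans hx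
  rw [← (Commute.all x y).geom_sum₂_mul, norm_mul]
  refine mul_le_mul_of_nonneg_right ?_ (norm_nonneg _)
  refine IsUltrametricDist.norm_sum_le_of_forall_le_of_nonneg (by positivity) fun i hi => ?_
  rw [norm_mul, norm_pow, norm_pow]
  have hi' : i + (n - i) = n := by
    have := Finset.mem_range.1 hi
    omega
  calc ‖x‖ ^ i * ‖y‖ ^ (n + 1 - 1 - i) ≤ s ^ i * s ^ (n - i) := by
        rw [Nat.add_sub_cancel]; gcongr
    _ = s ^ n := by rw [← pow_add, hi']

theorem norm_pow_prime_sub_le {p : ℕ} (hp : p.Prime) {x y : K} (hx : ‖x‖ ≤ 1) (hy : ‖y‖ ≤ 1) :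
    ‖x ^ p - y ^ p‖ ≤ max (‖x - y‖ ^ p) (‖(p : K)‖ * ‖y‖ * ‖x - y‖) := by
  have hd : ‖x - y‖ ≤ 1 := norm_sub_le_of_le_of_le hx hy
  have key := add_pow_prime_eq hp y (x - y)
  rw [add_sub_cancel] at key
  rw [key, add_assoc, add_sub_cancel_left]
  refine (IsUltrametricDist.norm_add_le_max _ _).trans (max_le_max (norm_pow _ _).le ?_)
  rw [norm_mul, norm_mul, norm_mul]
  refine mul_le_of_le_one_right (by positivity) ?_
  refine IsUltrametricDist.norm_sum_le_of_forall_le_of_nonneg zero_le_one fun i _ => ?_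
  rw [norm_mul, norm_mul, norm_pow, norm_pow]
  exact mul_le_one₀ (mul_le_one₀ (pow_le_one₀ (norm_nonneg _) hy) (by positivity)
    (pow_le_one₀ (norm_nonneg _) hd)) (norm_nonneg _) (IsUltrametricDist.norm_natCast_le_one K _)

/-- A polynomial without roots in a closed ball has constant norm on it. -/
theorem Polynomial.exists_isRoot_of_norm_ne [IsAlgClosed K] (G : Polynomial K) {c x y : K} {r : ℝ}
    (hx : x ∈ closedBall c r) (hy : y ∈ closedBall c r) (hne : ‖G.eval x‖ ≠ ‖G.eval y‖) :
    ∃ z ∈ closedBall c r, G.eval z = 0 := by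
  by_contra! hcon
  have hG : G ≠ 0 := by
    rintro rfl
    simp at hne
  have hsplit := IsAlgClosed.splits G
  have hxy : ‖x - y‖ ≤ r := by
    rw [mem_closedBall, dist_eq_norm] at hx hy
    have := norm_sub_le_of_le_of_le hx hy
    rwa [sub_sub_sub_cancel_right] at this
  apply hne
  rw [hsplit.eval_eq_prod_roots, hsplit.eval_eq_prod_roots, norm_mul, norm_mul]
  congr 1
  rw [← coe_nnnorm, ← coe_nnnorm, NNReal.coe_inj]
  change nnnormHom _ = nnnormHom _
  rw [map_multiset_prod, map_multiset_prod, Multiset.map_map, Multiset.map_map]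
  congr 1
  refine Multiset.map_congr rfl fun u hu => ?_
  have hu0 : G.eval u = 0 := (Polynomial.mem_roots'.1 hu).2
  have hur : r < ‖u - y‖ := by
    by_contra! hle
    refine hcon u ?_ hu0
    rw [mem_closedBall, dist_eq_norm] at hy ⊢
    have := norm_add_le_of_le_of_le hle hy
    rwa [sub_add_sub_cancel] at this
  have : ‖x - u‖ = ‖y - u‖ := by
    refine norm_eq_of_norm_sub_lt_left ?_
    rw [sub_sub_sub_cancel_right, norm_sub_rev y u]
    exact hxy.trans_lt hur
  simpa [← NNReal.coe_inj] using this

end Ultrametric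

section PolyApprox

variable {K : Type*} [NontriviallyNormedField K]

/-- `F` is a uniform limit of polynomials on `D`. -/
def PolyApprox (D : Set K) (F : K → K) : Prop :=
  ∀ τ : ℝ, 0 < τ → ∃ G : Polynomial K, ∀ z ∈ D, ‖F z - G.eval z‖ ≤ τ

theorem PolyApprox.mono {D D' : Set K} {F : K → K} (h : PolyApprox D F) (hD : D' ⊆ D) :
    PolyApprox D' F := fun τ hτ =>
  let ⟨G, hG⟩ := h τ hτ
  ⟨G, fun z hz => hG z (hD hz)⟩

theorem PolyApprox.congr {D : Set K} {F F' : K → K} (h : PolyApprox D F)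
    (hF : ∀ z ∈ D, F' z = F z) : PolyApprox D F' := fun τ hτ =>
  let ⟨G, hG⟩ := h τ hτ
  ⟨G, fun z hz => by rw [hF z hz]; exact hG z hz⟩

theorem PolyApprox.const (D : Set K) (b : K) : PolyApprox D fun _ => b := fun τ hτ =>
  ⟨Polynomial.C b, fun z _ => by simpa using hτ.le⟩

theorem PolyApprox.id (D : Set K) : PolyApprox D fun z => z := fun τ hτ =>
  ⟨Polynomial.X, fun z _ => by simpa using hτ.le⟩

theorem PolyApprox.of_uniform_limit {D : Set K} {F : K → K}
    (h : ∀ τ : ℝ, 0 < τ → ∃ H : K → K, PolyApprox D H ∧ ∀ z ∈ D, ‖F z - H z‖ ≤ τ) :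
    PolyApprox D F := by
  intro τ hτ
  obtain ⟨H, hH, hFH⟩ := h (τ / 2) (by positivity)
  obtain ⟨G, hG⟩ := hH (τ / 2) (by positivity)
  refine ⟨G, fun z hz => ?_⟩
  calc ‖F z - G.eval z‖ = ‖(F z - H z) + (H z - G.eval z)‖ := by rw [sub_add_sub_cancel]
    _ ≤ _ := norm_add_le _ _
    _ ≤ τ / 2 + τ / 2 := add_le_add (hFH z hz) (hG z hz)
    _ = τ := add_halves τ

theorem PolyApprox.add {D : Set K} {F H : K → K} (hF : PolyApprox D F) (hH : PolyApprox D H) :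
    PolyApprox D fun z => F z + H z := by
  intro τ hτ
  obtain ⟨G₁, h₁⟩ := hF (τ / 2) (by positivity)
  obtain ⟨G₂, h₂⟩ := hH (τ / 2) (by positivity)
  refine ⟨G₁ + G₂, fun z hz => ?_⟩
  rw [Polynomial.eval_add, add_sub_add_comm]
  exact (norm_add_le _ _).trans ((add_le_add (h₁ z hz) (h₂ z hz)).trans (add_halves τ).le)

theorem Polynomial.exists_norm_eval_le_of_isBounded {D : Set K} (hD : Bornology.IsBounded D)
    (G : Polynomial K) : ∃ b : ℝ, 0 < b ∧ ∀ z ∈ D, ‖G.eval z‖ ≤ b := by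
  obtain ⟨r, hr, hDr⟩ := hD.exists_pos_norm_le
  refine ⟨∑ i ∈ Finset.range (G.natDegree + 1), ‖G.coeff i‖ * r ^ i + 1, by positivity,
    fun z hz => ?_⟩
  rw [Polynomial.eval_eq_sum_range]
  refine (norm_sum_le _ _).trans (le_add_of_le_of_nonneg (Finset.sum_le_sum fun i _ => ?_)
    zero_le_one)
  rw [norm_mul, norm_pow]
  gcongr
  exact hDr z hz

theorem PolyApprox.exists_norm_le {D : Set K} (hD : Bornology.IsBounded D) {F : K → K}
    (hF : PolyApprox D F) : ∃ b : ℝ, 0 < b ∧ ∀ z ∈ D, ‖F z‖ ≤ b := by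
  obtain ⟨G, hG⟩ := hF 1 zero_lt_one
  obtain ⟨b, hb, hGb⟩ := G.exists_norm_eval_le_of_isBounded hD
  refine ⟨1 + b, by positivity, fun z hz => ?_⟩
  have := (norm_add_le (F z - G.eval z) (G.eval z)).trans (add_le_add (hG z hz) (hGb z hz))
  rwa [sub_add_cancel] at this

theorem PolyApprox.mul {D : Set K} (hD : Bornology.IsBounded D) {F H : K → K}
    (hF : PolyApprox D F) (hH : PolyApprox D H) : PolyApprox D fun z => F z * H z := by
  intro τ hτ
  obtain ⟨b, hb, hFb⟩ := hF.exists_norm_le hD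
  obtain ⟨G₂, h₂⟩ := hH (τ / 2 / b) (by positivity)
  obtain ⟨c, hc, hGc⟩ := G₂.exists_norm_eval_le_of_isBounded hD
  obtain ⟨G₁, h₁⟩ := hF (τ / 2 / c) (by positivity)
  refine ⟨G₁ * G₂, fun z hz => ?_⟩
  have e : F z * H z - (G₁ * G₂).eval z
      = F z * (H z - G₂.eval z) + (F z - G₁.eval z) * G₂.eval z := by
    rw [Polynomial.eval_mul]; ring
  rw [e]
  refine (norm_add_le _ _).trans ?_
  rw [norm_mul, norm_mul]
  calc ‖F z‖ * ‖H z - G₂.eval z‖ + ‖F z - G₁.eval z‖ * ‖G₂.eval z‖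
      ≤ b * (τ / 2 / b) + (τ / 2 / c) * c := by
        gcongr
        exacts [hFb z hz, h₂ z hz, h₁ z hz, hGc z hz]
    _ = τ := by field_simp; ring

theorem PolyApprox.pow {D : Set K} (hD : Bornology.IsBounded D) {F : K → K}
    (hF : PolyApprox D F) (n : ℕ) : PolyApprox D fun z => F z ^ n := by
  induction n with
  | zero => simpa using PolyApprox.const D 1
  | succ n ih => simpa [pow_succ] using ih.mul hD hF

theorem PolyApprox.sum {D : Set K} {F : ℕ → K → K} (hF : ∀ i, PolyApprox D (F i)) (n : ℕ) :
    PolyApprox D fun z => ∑ i ∈ Finset.range n, F i z := by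
  induction n with
  | zero => simpa using PolyApprox.const D 0
  | succ n ih => simpa [Finset.sum_range_succ] using ih.add (hF n)

theorem PolyApprox.sub {D : Set K} (hD : Bornology.IsBounded D) {F H : K → K}
    (hF : PolyApprox D F) (hH : PolyApprox D H) : PolyApprox D fun z => F z - H z :=
  (hF.add ((PolyApprox.const D (-1)).mul hD hH)).congr fun z _ => by ring

/-- A uniform limit of polynomials on a closed ball whose norm is not constant comes arbitrarily
close to zero. -/
theorem PolyApprox.exists_norm_le_of_norm_ne [IsUltrametricDist K] [IsAlgClosed K] {F : K → K}
    {c x y : K} {r : ℝ} (hF : PolyApprox (closedBall c r) F) (hx : x ∈ closedBall c r)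
    (hy : y ∈ closedBall c r) (hne : ‖F x‖ ≠ ‖F y‖) {τ : ℝ} (hτ : 0 < τ) :
    ∃ z ∈ closedBall c r, ‖F z‖ ≤ τ := by
  have hpos : 0 < |‖F x‖ - ‖F y‖| := abs_pos.2 (sub_ne_zero.2 hne)
  obtain ⟨G, hG⟩ := hF (min τ (|‖F x‖ - ‖F y‖| / 3)) (by positivity)
  have hx' := (abs_norm_sub_norm_le _ _).trans ((hG x hx).trans (min_le_right _ _))
  have hy' := (abs_norm_sub_norm_le _ _).trans ((hG y hy).trans (min_le_right _ _))
  have hGne : ‖G.eval x‖ ≠ ‖G.eval y‖ := by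
    intro heq
    rw [heq] at hx'
    have := abs_sub_le ‖F x‖ ‖G.eval y‖ ‖F y‖
    rw [abs_sub_comm ‖G.eval y‖] at this
    linarith
  obtain ⟨z, hz, hz0⟩ := G.exists_isRoot_of_norm_ne hx hy hGne
  refine ⟨z, hz, ?_⟩
  have := (hG z hz).trans (min_le_left _ _)
  rwa [hz0, sub_zero] at this

end PolyApprox

/-- The standing hypotheses on the prime, the perturbation `Q`, and two auxiliary elements of
norms `p ^ (-1 / (p - 1))` and `p ^ (-1 / p)`. -/
structure PerturbationData {K : Type*} [NontriviallyNormedField K] (p : ℕ) (a : ℕ → K)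
    (rhat C : ℝ) (ϖ ϑ : K) : Prop where
  prime : p.Prime
  norm_p : ‖(p : K)‖ = (p : ℝ)⁻¹
  one_lt_rhat : 1 < rhat
  coeff_le : ∀ i, ‖a i‖ * rhat ^ i ≤ C
  ϖ_pow : ϖ ^ (p - 1) = p
  ϑ_pow : ϑ ^ p = p
  C_lt : C < ‖ϖ‖

namespace PerturbationData

variable {K : Type*} [NontriviallyNormedField K] {p : ℕ} {a : ℕ → K} {rhat C : ℝ} {ϖ ϑ : K}

theorem two_le (S : PerturbationData p a rhat C ϖ ϑ) : (2 : ℝ) ≤ p := by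
  exact_mod_cast S.prime.two_le

theorem p_pos (S : PerturbationData p a rhat C ϖ ϑ) : (0 : ℝ) < p := by
  linarith [S.two_le]

theorem cast_ne_zero (S : PerturbationData p a rhat C ϖ ϑ) : (p : K) ≠ 0 := by
  rw [← norm_pos_iff, S.norm_p]
  exact inv_pos.2 S.p_pos

theorem norm_ϑ_pow (S : PerturbationData p a rhat C ϖ ϑ) : (p : ℝ) * ‖ϑ‖ ^ p = 1 := by
  rw [← norm_pow, S.ϑ_pow, S.norm_p, mul_inv_cancel₀ S.p_pos.ne']

theorem norm_ϖ_pow (S : PerturbationData p a rhat C ϖ ϑ) : (p : ℝ) * ‖ϖ‖ ^ p = ‖ϖ‖ := by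
  have : ‖ϖ‖ ^ p = ‖ϖ‖ ^ (p - 1) * ‖ϖ‖ := by
    rw [← pow_succ, Nat.sub_add_cancel S.prime.one_le]
  rw [this, ← norm_pow, S.ϖ_pow, S.norm_p, ← mul_assoc, mul_inv_cancel₀ S.p_pos.ne', one_mul]

theorem C_nonneg (S : PerturbationData p a rhat C ϖ ϑ) : 0 ≤ C :=
  (by have := S.one_lt_rhat; positivity : 0 ≤ ‖a 0‖ * rhat ^ 0).trans (S.coeff_le 0)

theorem ϖ_pos (S : PerturbationData p a rhat C ϖ ϑ) : 0 < ‖ϖ‖ := S.C_nonneg.trans_lt S.C_lt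

theorem ϖ_lt_one (S : PerturbationData p a rhat C ϖ ϑ) : ‖ϖ‖ < 1 := by
  by_contra! h
  have h1 : ‖ϖ‖ ≤ ‖ϖ‖ ^ p := le_self_pow₀ h S.prime.ne_zero
  have := S.norm_ϖ_pow
  nlinarith [S.two_le]

theorem ϑ_pos (S : PerturbationData p a rhat C ϖ ϑ) : 0 < ‖ϑ‖ := by
  refine (norm_nonneg _).lt_of_ne' fun h => ?_
  have := S.norm_ϑ_pow
  rw [h, zero_pow S.prime.ne_zero] at this
  simp at this

theorem ϑ_lt_one (S : PerturbationData p a rhat C ϖ ϑ) : ‖ϑ‖ < 1 := by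
  by_contra! h
  have h1 : 1 ≤ ‖ϑ‖ ^ p := one_le_pow₀ h
  have := S.norm_ϑ_pow
  nlinarith [S.two_le]

theorem ϖ_lt_ϑ (S : PerturbationData p a rhat C ϖ ϑ) : ‖ϖ‖ < ‖ϑ‖ := by
  refine lt_of_pow_lt_pow_left₀ p (norm_nonneg _) ?_
  have h1 := S.norm_ϖ_pow
  have h2 := S.norm_ϑ_pow
  have h3 := S.ϖ_lt_one
  exact lt_of_mul_lt_mul_left (by linarith) S.p_pos.le

theorem inv_le_ϑ (S : PerturbationData p a rhat C ϖ ϑ) : (p : ℝ)⁻¹ ≤ ‖ϑ‖ := by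
  have h : ‖ϑ‖ ^ p = (p : ℝ)⁻¹ := eq_inv_of_mul_eq_one_right S.norm_ϑ_pow
  rw [← h]
  exact pow_le_of_le_one (norm_nonneg _) S.ϑ_lt_one.le S.prime.ne_zero

theorem inv_lt_one (S : PerturbationData p a rhat C ϖ ϑ) : (p : ℝ)⁻¹ < 1 :=
  inv_lt_one_of_one_lt₀ (by linarith [S.two_le])

theorem norm_coeff_le (S : PerturbationData p a rhat C ϖ ϑ) (i : ℕ) :
    ‖a i‖ ≤ C * (rhat⁻¹) ^ i := by
  have h0 : 0 < rhat ^ i := pow_pos (zero_lt_one.trans S.one_lt_rhat) i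
  rw [inv_pow, ← div_eq_mul_inv, le_div_iff₀ h0]
  exact S.coeff_le i

theorem rhat_inv_nonneg (S : PerturbationData p a rhat C ϖ ϑ) : 0 ≤ rhat⁻¹ :=
  inv_nonneg.2 (zero_lt_one.trans S.one_lt_rhat).le

theorem rhat_inv_lt_one (S : PerturbationData p a rhat C ϖ ϑ) : rhat⁻¹ < 1 :=
  inv_lt_one_of_one_lt₀ S.one_lt_rhat

theorem norm_coeff_le_C (S : PerturbationData p a rhat C ϖ ϑ) (i : ℕ) : ‖a i‖ ≤ C :=
  (S.norm_coeff_le i).trans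
    (mul_le_of_le_one_right S.C_nonneg (pow_le_one₀ S.rhat_inv_nonneg S.rhat_inv_lt_one.le))

theorem norm_term_le {z : K} (hz : ‖z‖ ≤ 1) (i : ℕ) :
    ‖a i * z ^ i‖ ≤ ‖a i‖ := by
  rw [norm_mul, norm_pow]
  exact mul_le_of_le_one_right (norm_nonneg _) (pow_le_one₀ (norm_nonneg _) hz)

theorem norm_one_sub_le {z : K} [IsUltrametricDist K] (hz : ‖z‖ ≤ 1) : ‖1 - z‖ ≤ 1 :=
  norm_sub_le_of_le_of_le norm_one.le hz

theorem norm_one_sub_eq {z : K} [IsUltrametricDist K] (hz : ‖z‖ < 1) : ‖1 - z‖ = 1 := by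
  have := norm_add_eq_left_of_lt (x := (1 : K)) (y := -z) (by simpa using hz)
  simpa [sub_eq_add_neg] using this

theorem summable [CompleteSpace K] (S : PerturbationData p a rhat C ϖ ϑ) {z : K} (hz : ‖z‖ ≤ 1) :
    Summable fun i => a i * z ^ i :=
  Summable.of_norm_bounded
    ((summable_geometric_of_lt_one S.rhat_inv_nonneg S.rhat_inv_lt_one).mul_left C)
    fun i => (norm_term_le hz i).trans (S.norm_coeff_le i)

theorem Qstar_eq (p : ℕ) (a : ℕ → K) (lam z : K) :
    Qstar p a lam z = lam / p * (z ^ p * (1 - z)) + (z ^ (p + 1) + Qser a z) := by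
  unfold Qstar Pfam
  ring

theorem lt_mul_pow (S : PerturbationData p a rhat C ϖ ϑ) {s : ℝ} (hs : ‖ϖ‖ < s) :
    s < p * s ^ p := by
  have h0 := S.ϖ_pos
  have hp := S.prime.two_le
  have h1 : (p : ℝ) * ‖ϖ‖ ^ (p - 1) = 1 := by
    rw [← norm_pow, S.ϖ_pow, S.norm_p, mul_inv_cancel₀ S.p_pos.ne']
  have h2 : s ^ p = s ^ (p - 1) * s := by
    rw [← pow_succ, Nat.sub_add_cancel S.prime.one_le]
  have h3 : ‖ϖ‖ ^ (p - 1) < s ^ (p - 1) := pow_lt_pow_left₀ hs h0.le (by omega)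
  have h4 : 1 < p * s ^ (p - 1) := by
    rw [← h1]
    exact mul_lt_mul_of_pos_left h3 S.p_pos
  rw [h2, ← mul_assoc]
  exact lt_mul_of_one_lt_left (h0.trans hs) h4

theorem norm_Qstar_sub_param (S : PerturbationData p a rhat C ϖ ϑ) (lam lam' z : K) :
    ‖Qstar p a lam z - Qstar p a lam' z‖ = p * ‖z‖ ^ p * ‖1 - z‖ * ‖lam - lam'‖ := by
  have e : Qstar p a lam z - Qstar p a lam' z = (lam - lam') / p * (z ^ p * (1 - z)) := by
    rw [Qstar_eq, Qstar_eq]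
    ring
  rw [e, norm_mul, norm_div, S.norm_p, norm_mul, norm_pow, div_inv_eq_mul]
  ring

theorem mul_mul_pow (S : PerturbationData p a rhat C ϖ ϑ) (u : ℝ) (k : ℕ) :
    p * (‖ϖ‖ * u ^ p ^ k) ^ p = ‖ϖ‖ * u ^ p ^ (k + 1) := by
  rw [mul_pow, ← mul_assoc, S.norm_ϖ_pow, ← pow_mul, ← pow_succ]

variable [IsUltrametricDist K]

theorem norm_Qser_le (S : PerturbationData p a rhat C ϖ ϑ) {z : K} (hz : ‖z‖ ≤ 1) :
    ‖Qser a z‖ ≤ C :=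
  IsUltrametricDist.norm_tsum_le_of_forall_le_of_nonneg S.C_nonneg fun i =>
    (norm_term_le hz i).trans (S.norm_coeff_le_C i)

theorem norm_Qser_sub_le [CompleteSpace K]
    (S : PerturbationData p a rhat C ϖ ϑ) {z w : K} (hz : ‖z‖ ≤ 1)
    (hw : ‖w‖ ≤ 1) : ‖Qser a z - Qser a w‖ ≤ C * ‖z - w‖ := by
  unfold Qser
  rw [← (S.summable hz).tsum_sub (S.summable hw)]
  refine IsUltrametricDist.norm_tsum_le_of_forall_le_of_nonneg
    (mul_nonneg S.C_nonneg (norm_nonneg _)) fun i => ?_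
  rw [← mul_sub, norm_mul]
  exact mul_le_mul (S.norm_coeff_le_C i) (norm_pow_sub_pow_le hz hw i) (norm_nonneg _) S.C_nonneg

theorem norm_Qser_sub_sum_le [CompleteSpace K]
    (S : PerturbationData p a rhat C ϖ ϑ) {z : K} (hz : ‖z‖ ≤ 1)
    (d : ℕ) : ‖Qser a z - ∑ i ∈ Finset.range d, a i * z ^ i‖ ≤ C * (rhat⁻¹) ^ d := by
  have h := (S.summable hz).sum_add_tsum_nat_add d
  have h' : Qser a z - ∑ i ∈ Finset.range d, a i * z ^ i = ∑' i, a (i + d) * z ^ (i + d) := by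
    unfold Qser
    rw [← h, add_sub_cancel_left]
  rw [h']
  refine IsUltrametricDist.norm_tsum_le_of_forall_le_of_nonneg
    (mul_nonneg S.C_nonneg (pow_nonneg S.rhat_inv_nonneg _)) fun i => ?_
  refine (norm_term_le hz _).trans ((S.norm_coeff_le _).trans ?_)
  exact mul_le_mul_of_nonneg_left (pow_le_pow_of_le_one S.rhat_inv_nonneg S.rhat_inv_lt_one.le
    (Nat.le_add_left d i)) S.C_nonneg

theorem polyApprox_Qstar [CompleteSpace K]
    (S : PerturbationData p a rhat C ϖ ϑ) {D : Set K}
    (hD : Bornology.IsBounded D) {L F : K → K} (hL : PolyApprox D L) (hF : PolyApprox D F)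
    (hF1 : ∀ z ∈ D, ‖F z‖ ≤ 1) : PolyApprox D fun z => Qstar p a (L z) (F z) := by
  have hLp : PolyApprox D fun z => L z / (p : K) :=
    (hL.mul hD (PolyApprox.const D (p : K)⁻¹)).congr fun z _ => div_eq_mul_inv _ _
  have hP : PolyApprox D fun z => Pfam p (L z) (F z) :=
    (hLp.mul hD (hF.pow hD p)).add (((PolyApprox.const D 1).sub hD hLp).mul hD (hF.pow hD (p + 1)))
  refine hP.add (PolyApprox.of_uniform_limit fun τ hτ => ?_)
  have htend : Tendsto (fun d : ℕ => C * (rhat⁻¹) ^ d) atTop (nhds (C * 0)) :=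
    (tendsto_pow_atTop_nhds_zero_of_lt_one S.rhat_inv_nonneg S.rhat_inv_lt_one).const_mul C
  rw [mul_zero] at htend
  obtain ⟨d, hd⟩ := (htend.eventually (gt_mem_nhds hτ)).exists
  exact ⟨fun z => ∑ i ∈ Finset.range d, a i * F z ^ i,
    PolyApprox.sum (fun i => (PolyApprox.const D (a i)).mul hD (hF.pow hD i)) d,
    fun z hz => (S.norm_Qser_sub_sum_le (hF1 z hz) d).trans hd.le⟩

theorem norm_lam_div (S : PerturbationData p a rhat C ϖ ϑ) {lam : K} (hl : ‖lam - 1‖ < 1) :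
    ‖lam / (p : K)‖ = p := by
  rw [norm_div, norm_eq_one_of_norm_sub_one_lt hl, S.norm_p, one_div, inv_inv]

theorem norm_Qstar_le (S : PerturbationData p a rhat C ϖ ϑ) {lam : K} (hl : ‖lam - 1‖ < 1) {z : K}
    (hz : ‖z‖ ≤ 1) : ‖Qstar p a lam z‖ ≤ max (p * ‖z‖ ^ p) C := by
  rw [Qstar_eq]
  refine norm_add_le_of_le_of_le (le_max_of_le_left ?_)
    (norm_add_le_of_le_of_le (le_max_of_le_left ?_) (le_max_of_le_right (S.norm_Qser_le hz)))
  · rw [norm_mul, S.norm_lam_div hl, norm_mul, norm_pow]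
    exact mul_le_mul_of_nonneg_left
      (mul_le_of_le_one_right (by positivity) (norm_one_sub_le hz)) S.p_pos.le
  · rw [norm_pow, pow_succ, mul_comm]
    exact mul_le_mul_of_nonneg_right (by linarith [S.two_le]) (by positivity)

theorem norm_Qstar_le_ϖ (S : PerturbationData p a rhat C ϖ ϑ) {lam : K} (hl : ‖lam - 1‖ < 1)
    {z : K} (hz : ‖z‖ ≤ ‖ϖ‖) : ‖Qstar p a lam z‖ ≤ ‖ϖ‖ := by
  refine (S.norm_Qstar_le hl (hz.trans S.ϖ_lt_one.le)).trans (max_le ?_ S.C_lt.le)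
  have := S.p_pos
  calc (p : ℝ) * ‖z‖ ^ p ≤ p * ‖ϖ‖ ^ p := by gcongr
    _ = ‖ϖ‖ := S.norm_ϖ_pow

theorem norm_Qstar_eq (S : PerturbationData p a rhat C ϖ ϑ) {lam : K} (hl : ‖lam - 1‖ < 1) {z : K}
    (hz : ‖ϖ‖ < ‖z‖) (hz1 : ‖z‖ < 1) : ‖Qstar p a lam z‖ = p * ‖z‖ ^ p := by
  have hmain : ‖lam / p * (z ^ p * (1 - z))‖ = p * ‖z‖ ^ p := by
    rw [norm_mul, S.norm_lam_div hl, norm_mul, norm_pow, norm_one_sub_eq hz1, mul_one]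
  rw [Qstar_eq, norm_add_eq_left_of_lt, hmain]
  rw [hmain]
  have h0 := S.ϖ_pos.trans hz
  refine norm_add_lt_of_lt_of_lt ?_ ?_
  · rw [norm_pow, pow_succ, mul_comm]
    exact mul_lt_mul_of_pos_right (by linarith [S.two_le]) (by positivity)
  · exact (S.norm_Qser_le hz1.le).trans_lt (S.C_lt.trans (hz.trans (S.lt_mul_pow hz)))

/-- Near `1` the map is close to the dilation by `-λ / p`. -/
theorem norm_Qstar_sub_add_le [CompleteSpace K]
    (S : PerturbationData p a rhat C ϖ ϑ) {lam : K}
    (hl : ‖lam - 1‖ < 1) {z w : K} {κ : ℝ} (hκ : κ < 1) (hz : ‖z - 1‖ ≤ κ) (hw : ‖w - 1‖ ≤ κ) :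
    ‖Qstar p a lam z - Qstar p a lam w + lam / p * (z - w)‖ ≤ max (p * κ) 1 * ‖z - w‖ := by
  have hz1 := (norm_eq_one_of_norm_sub_one_lt (hz.trans_lt hκ)).le
  have hw1 := (norm_eq_one_of_norm_sub_one_lt (hw.trans_lt hκ)).le
  have e : Qstar p a lam z - Qstar p a lam w + lam / p * (z - w) =
      lam / p * ((z ^ p - w ^ p) * (1 - z) + (1 - w ^ p) * (z - w)) +
      ((z ^ (p + 1) - w ^ (p + 1)) + (Qser a z - Qser a w)) := by
    rw [Qstar_eq, Qstar_eq]
    ring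
  have hzw := norm_pow_sub_pow_le hz1 hw1 p
  rw [e, max_mul_of_nonneg _ _ (norm_nonneg _)]
  refine norm_add_le_of_le_of_le (le_max_of_le_left ?_) (le_max_of_le_right ?_)
  · rw [norm_mul, S.norm_lam_div hl, mul_assoc]
    refine mul_le_mul_of_nonneg_left (norm_add_le_of_le_of_le ?_ ?_) S.p_pos.le
    · rw [norm_mul, mul_comm, norm_sub_rev 1 z]
      exact mul_le_mul hz hzw (norm_nonneg _) ((norm_nonneg _).trans hz)
    · rw [norm_mul]
      refine mul_le_mul_of_nonneg_right (le_trans ?_ hw) (norm_nonneg _)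
      have := norm_pow_sub_pow_le (norm_one (α := K)).le hw1 p
      rwa [one_pow, norm_sub_rev 1 w] at this
  · rw [one_mul]
    refine norm_add_le_of_le_of_le (norm_pow_sub_pow_le hz1 hw1 _) ?_
    refine (S.norm_Qser_sub_le hz1 hw1).trans (mul_le_of_le_one_left (norm_nonneg _) ?_)
    exact (S.C_lt.trans S.ϖ_lt_one).le

theorem norm_Qstar_sub_eq [CompleteSpace K]
    (S : PerturbationData p a rhat C ϖ ϑ) {lam : K}
    (hl : ‖lam - 1‖ < 1) {z w : K} (hz : ‖z - 1‖ < 1) (hw : ‖w - 1‖ < 1) :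
    ‖Qstar p a lam z - Qstar p a lam w‖ = p * ‖z - w‖ := by
  rcases eq_or_ne z w with rfl | hne
  · simp
  have hpos : 0 < ‖z - w‖ := norm_pos_iff.2 (sub_ne_zero.2 hne)
  have h := S.norm_Qstar_sub_add_le hl (max_lt hz hw) (le_max_left _ _) (le_max_right _ _)
  have hlt : max (p * max ‖z - 1‖ ‖w - 1‖) 1 * ‖z - w‖ < p * ‖z - w‖ := by
    refine mul_lt_mul_of_pos_right (max_lt ?_ (by linarith [S.two_le])) hpos
    exact mul_lt_of_lt_one_right S.p_pos (max_lt hz hw)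
  have hn : ‖-(lam / p * (z - w))‖ = p * ‖z - w‖ := by
    rw [norm_neg, norm_mul, S.norm_lam_div hl]
  rw [← hn]
  refine norm_eq_of_norm_sub_lt_left ?_
  rw [hn, sub_neg_eq_add]
  exact h.trans_lt hlt

/-- Contraction estimate near `0`. -/
theorem norm_Qstar_sub_le [CompleteSpace K]
    (S : PerturbationData p a rhat C ϖ ϑ) {lam : K}
    (hl : ‖lam - 1‖ < 1) {z w : K} {s b : ℝ} (hz : ‖z‖ ≤ s) (hw : ‖w‖ ≤ s) (hs : s ≤ ‖ϑ‖)
    (hzw : ‖z - w‖ ≤ ((p : ℝ)⁻¹) ^ 2) (hsb : p * s ^ p ≤ b) (hb : ‖ϑ‖ ≤ b) :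
    ‖Qstar p a lam z - Qstar p a lam w‖ ≤ b * ‖z - w‖ := by
  have hs1 : s ≤ 1 := hs.trans S.ϑ_lt_one.le
  have hs0 : 0 ≤ s := (norm_nonneg _).trans hz
  have hz1 := hz.trans hs1
  have hw1 := hw.trans hs1
  have hp := S.p_pos
  have hpinv : (0 : ℝ) < (p : ℝ)⁻¹ := inv_pos.2 hp
  have e : Qstar p a lam z - Qstar p a lam w = lam / p * (z ^ p - w ^ p) +
      ((z ^ (p + 1) - w ^ (p + 1)) + (- (lam / p * (z ^ (p + 1) - w ^ (p + 1))) +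
        (Qser a z - Qser a w))) := by
    rw [Qstar_eq, Qstar_eq]
    ring
  have hpow : ‖z ^ (p + 1) - w ^ (p + 1)‖ ≤ s ^ p * ‖z - w‖ :=
    norm_pow_succ_sub_pow_succ_le hz hw p
  have hpow' : p * ‖z ^ (p + 1) - w ^ (p + 1)‖ ≤ b * ‖z - w‖ := by
    calc p * ‖z ^ (p + 1) - w ^ (p + 1)‖ ≤ p * (s ^ p * ‖z - w‖) := by gcongr
      _ = p * s ^ p * ‖z - w‖ := by ring
      _ ≤ b * ‖z - w‖ := by gcongr
  rw [e]
  refine norm_add_le_of_le_of_le ?_ (norm_add_le_of_le_of_le ?_ (norm_add_le_of_le_of_le ?_ ?_))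
  · rw [norm_mul, S.norm_lam_div hl]
    have h1 := norm_pow_prime_sub_le S.prime hz1 hw1
    have hle1 : ‖z - w‖ ≤ 1 := norm_sub_le_of_le_of_le hz1 hw1
    have h2 : ‖z - w‖ ^ p ≤ ((p : ℝ)⁻¹) ^ 2 * ‖z - w‖ := by
      calc ‖z - w‖ ^ p ≤ ‖z - w‖ ^ 2 :=
            pow_le_pow_of_le_one (norm_nonneg _) hle1 S.prime.two_le
        _ = ‖z - w‖ * ‖z - w‖ := sq _
        _ ≤ _ := by gcongr
    have h3 : p * ‖z - w‖ ^ p ≤ b * ‖z - w‖ := by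
      calc p * ‖z - w‖ ^ p ≤ p * (((p : ℝ)⁻¹) ^ 2 * ‖z - w‖) := by gcongr
        _ = (p : ℝ)⁻¹ * ‖z - w‖ := by field_simp
        _ ≤ b * ‖z - w‖ := by
          gcongr
          exact S.inv_le_ϑ.trans hb
    have h4 : p * (‖(p : K)‖ * ‖w‖ * ‖z - w‖) ≤ b * ‖z - w‖ := by
      rw [S.norm_p]
      calc p * ((p : ℝ)⁻¹ * ‖w‖ * ‖z - w‖) = ‖w‖ * ‖z - w‖ := by field_simp
        _ ≤ b * ‖z - w‖ := by
          gcongr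
          exact hw.trans (hs.trans hb)
    calc p * ‖z ^ p - w ^ p‖ ≤ p * max (‖z - w‖ ^ p) (‖(p : K)‖ * ‖w‖ * ‖z - w‖) := by gcongr
      _ = max (p * ‖z - w‖ ^ p) (p * (‖(p : K)‖ * ‖w‖ * ‖z - w‖)) := mul_max_of_nonneg _ _ hp.le
      _ ≤ _ := max_le h3 h4
  · refine le_trans ?_ hpow'
    exact le_mul_of_one_le_left (norm_nonneg _) (by linarith [S.two_le])
  · rw [norm_neg, norm_mul, S.norm_lam_div hl]
    exact hpow'
  · refine (S.norm_Qser_sub_le hz1 hw1).trans (mul_le_mul_of_nonneg_right ?_ (norm_nonneg _))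
    exact (S.C_lt.trans S.ϖ_lt_ϑ).le.trans hb

end PerturbationData

namespace PerturbationData

variable {K : Type*} [NontriviallyNormedField K] [IsUltrametricDist K]
  {p : ℕ} {a : ℕ → K} {rhat C : ℝ} {ϖ ϑ : K} {h : K → K}

/-- `h` selects, for each parameter, the fixed point of `Q*_λ` near `1`. -/
def IsFixedPointNearOne (p : ℕ) (a : ℕ → K) (h : K → K) : Prop :=
  ∀ lam : K, ‖lam - 1‖ < 1 → ‖h lam - 1‖ ≤ ‖Qser a 1‖ / p ∧ Qstar p a lam (h lam) = h lam

theorem norm_fixed_sub_one_le (S : PerturbationData p a rhat C ϖ ϑ)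
    (hh : IsFixedPointNearOne p a h) {lam : K} (hl : ‖lam - 1‖ < 1) :
    ‖h lam - 1‖ ≤ C / p := by
  have := S.p_pos
  refine (hh lam hl).1.trans ?_
  gcongr
  exact S.norm_Qser_le norm_one.le

theorem norm_fixed_sub_one_le_inv (S : PerturbationData p a rhat C ϖ ϑ)
    (hh : IsFixedPointNearOne p a h) {lam : K} (hl : ‖lam - 1‖ < 1) :
    ‖h lam - 1‖ ≤ (p : ℝ)⁻¹ := by
  refine (S.norm_fixed_sub_one_le hh hl).trans ?_
  rw [div_eq_mul_inv]
  exact mul_le_of_le_one_left (inv_pos.2 S.p_pos).le (S.C_lt.trans S.ϖ_lt_one).le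

theorem norm_fixed_sub_one_lt (S : PerturbationData p a rhat C ϖ ϑ)
    (hh : IsFixedPointNearOne p a h) {lam : K} (hl : ‖lam - 1‖ < 1) : ‖h lam - 1‖ < 1 :=
  (S.norm_fixed_sub_one_le_inv hh hl).trans_lt S.inv_lt_one

theorem norm_fixed_sub_le [CompleteSpace K]
    (S : PerturbationData p a rhat C ϖ ϑ)
    (hh : IsFixedPointNearOne p a h) {lam lam' : K} (hl : ‖lam - 1‖ < 1) (hl' : ‖lam' - 1‖ < 1) :
    ‖h lam - h lam'‖ ≤ ‖ϑ‖ * ‖lam - lam'‖ := by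
  have h1 := S.norm_fixed_sub_one_lt hh hl
  have h1' := S.norm_fixed_sub_one_lt hh hl'
  have hp := S.p_pos
  have hexp := S.norm_Qstar_sub_eq hl h1 h1'
  have hpar := S.norm_Qstar_sub_param lam lam' (h lam')
  rw [norm_eq_one_of_norm_sub_one_lt h1', norm_sub_rev 1, one_pow, mul_one] at hpar
  have hpar' : ‖Qstar p a lam (h lam') - Qstar p a lam' (h lam')‖ ≤ ‖ϑ‖ * ‖lam - lam'‖ := by
    rw [hpar]
    gcongr
    calc p * ‖h lam' - 1‖ ≤ p * (C / p) := by
          gcongr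
          exact S.norm_fixed_sub_one_le hh hl'
      _ = C := by field_simp
      _ ≤ _ := (S.C_lt.trans S.ϖ_lt_ϑ).le
  have e : Qstar p a lam (h lam) - Qstar p a lam (h lam') =
      (h lam - h lam') - (Qstar p a lam (h lam') - Qstar p a lam' (h lam')) := by
    rw [(hh lam hl).2, (hh lam' hl').2]
    ring
  by_contra! hcon
  have hle : ‖Qstar p a lam (h lam) - Qstar p a lam (h lam')‖ ≤ ‖h lam - h lam'‖ := by
    rw [e]
    exact norm_sub_le_of_le_of_le le_rfl (hpar'.trans hcon.le)
  rw [hexp] at hle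
  have hpos : 0 < ‖h lam - h lam'‖ := lt_of_le_of_lt (by positivity) hcon
  nlinarith [S.two_le]

/-- The fixed point is a uniform limit of polynomials in the parameter. -/
theorem polyApprox_fixed [CompleteSpace K]
    (S : PerturbationData p a rhat C ϖ ϑ)
    (hh : IsFixedPointNearOne p a h) {c : K} {r : ℝ} (hc : ‖c - 1‖ < 1) (hr : r ≤ (p : ℝ)⁻¹) :
    PolyApprox (closedBall c r) h := by
  have hD : Bornology.IsBounded (closedBall c r) := isBounded_closedBall
  have hp := S.p_pos
  have hpinv : (0 : ℝ) < (p : ℝ)⁻¹ := inv_pos.2 hp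
  have hΛ : ∀ lam ∈ closedBall c r, ‖lam - 1‖ < 1 := fun lam hl => by
    rw [mem_closedBall, dist_eq_norm] at hl
    have := norm_add_lt_of_lt_of_lt ((hl.trans hr).trans_lt S.inv_lt_one) hc
    rwa [sub_add_sub_cancel] at this
  have hc1 := norm_eq_one_of_norm_sub_one_lt hc
  have hc0 : c ≠ 0 := norm_pos_iff.1 (by rw [hc1]; exact one_pos)
  have hpK := S.cast_ne_zero
  let Φ : K → K → K := fun lam z => z + p / c * (Qstar p a lam z - z)
  have hcontr : ∀ lam ∈ closedBall c r, ∀ z, ‖z - 1‖ ≤ (p : ℝ)⁻¹ →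
      ‖Φ lam z - h lam‖ ≤ (p : ℝ)⁻¹ * ‖z - h lam‖ := by
    intro lam hl z hz
    have hest := S.norm_Qstar_sub_add_le (hΛ lam hl) S.inv_lt_one hz
      (S.norm_fixed_sub_one_le_inv hh (hΛ lam hl))
    rw [mul_inv_cancel₀ hp.ne', max_self, one_mul, (hh lam (hΛ lam hl)).2] at hest
    have e : Φ lam z - h lam = (c - lam) / c * (z - h lam) +
        (p / c * (Qstar p a lam z - h lam + lam / p * (z - h lam)) - p / c * (z - h lam)) := by
      simp only [Φ]
      field_simp
      ring
    have hpc : ‖(p : K) / c‖ = (p : ℝ)⁻¹ := by rw [norm_div, hc1, S.norm_p, div_one]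
    rw [e]
    refine norm_add_le_of_le_of_le ?_ (norm_sub_le_of_le_of_le ?_ ?_)
    · rw [norm_mul, norm_div, hc1, div_one]
      rw [mem_closedBall, dist_comm, dist_eq_norm] at hl
      gcongr
      exact hl.trans hr
    · rw [norm_mul, hpc]
      gcongr
    · rw [norm_mul, hpc]
  have hiter : ∀ k : ℕ, ∀ lam ∈ closedBall c r, ‖(Φ lam)^[k] 1 - 1‖ ≤ (p : ℝ)⁻¹ ∧
      ‖(Φ lam)^[k] 1 - h lam‖ ≤ (p : ℝ)⁻¹ ^ k := by
    intro k lam hl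
    have hh1 := S.norm_fixed_sub_one_le_inv hh (hΛ lam hl)
    induction k with
    | zero =>
      simp only [Function.iterate_zero, id_eq, sub_self, norm_zero, pow_zero]
      refine ⟨hpinv.le, ?_⟩
      rw [norm_sub_rev]
      exact hh1.trans S.inv_lt_one.le
    | succ k ih =>
      rw [Function.iterate_succ_apply']
      have hk := hcontr lam hl _ ih.1
      have hk' : ‖Φ lam ((Φ lam)^[k] 1) - h lam‖ ≤ (p : ℝ)⁻¹ ^ (k + 1) := by
        refine hk.trans ?_
        rw [pow_succ']
        exact mul_le_mul_of_nonneg_left ih.2 hpinv.le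
      refine ⟨?_, hk'⟩
      have := norm_add_le_of_le_of_le
        (hk'.trans (pow_le_of_le_one hpinv.le S.inv_lt_one.le k.succ_ne_zero)) hh1
      rwa [sub_add_sub_cancel] at this
  have hpoly : ∀ k : ℕ, PolyApprox (closedBall c r) fun lam => (Φ lam)^[k] 1 := by
    intro k
    induction k with
    | zero => exact PolyApprox.const _ 1
    | succ k ih =>
      have hQ := S.polyApprox_Qstar hD (PolyApprox.id _) ih fun lam hl =>
        (norm_eq_one_of_norm_sub_one_lt (((hiter k lam hl).1).trans_lt S.inv_lt_one)).le
      refine (ih.add ((PolyApprox.const _ (p / c)).mul hD (hQ.sub hD ih))).congr fun lam _ => ?_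
      rw [Function.iterate_succ_apply']
  refine PolyApprox.of_uniform_limit fun τ hτ => ?_
  obtain ⟨k, hk⟩ := exists_pow_lt_of_lt_one hτ S.inv_lt_one
  refine ⟨_, hpoly k, fun lam hl => ?_⟩
  rw [norm_sub_rev]
  exact (hiter k lam hl).2.trans hk.le

theorem norm_iterate_sub_eq [CompleteSpace K]
    (S : PerturbationData p a rhat C ϖ ϑ) {lam : K}
    (hl : ‖lam - 1‖ < 1) {z w : K} {k : ℕ} (hz : ∀ j < k, ‖(Qstar p a lam)^[j] z - 1‖ < 1)
    (hw : ∀ j < k, ‖(Qstar p a lam)^[j] w - 1‖ < 1) :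
    ‖(Qstar p a lam)^[k] z - (Qstar p a lam)^[k] w‖ = p ^ k * ‖z - w‖ := by
  induction k with
  | zero => simp
  | succ k ih =>
    rw [Function.iterate_succ_apply', Function.iterate_succ_apply',
      S.norm_Qstar_sub_eq hl (hz k k.lt_succ_self) (hw k k.lt_succ_self),
      ih (fun j hj => hz j (hj.trans k.lt_succ_self)) (fun j hj => hw j (hj.trans k.lt_succ_self)),
      pow_succ]
    ring

theorem norm_iterate_sub_fixed [CompleteSpace K]
    (S : PerturbationData p a rhat C ϖ ϑ)
    (hh : IsFixedPointNearOne p a h) {lam : K} (hl : ‖lam - 1‖ < 1) {z : K} {k : ℕ}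
    (hz : p ^ k * ‖z - h lam‖ < p) :
    ‖(Qstar p a lam)^[k] z - h lam‖ = p ^ k * ‖z - h lam‖ ∧
      ∀ j < k, ‖(Qstar p a lam)^[j] z - 1‖ < 1 := by
  have hp := S.p_pos
  induction k with
  | zero => simp
  | succ k ih =>
    have hlt : p ^ k * ‖z - h lam‖ < 1 := by
      rw [pow_succ, mul_right_comm] at hz
      exact lt_of_mul_lt_mul_right (by rwa [one_mul]) hp.le
    obtain ⟨h1, h2⟩ := ih (hlt.trans (by linarith [S.two_le]))
    have hk : ‖(Qstar p a lam)^[k] z - 1‖ < 1 := by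
      have := norm_add_lt_of_lt_of_lt (h1.trans_lt hlt) (S.norm_fixed_sub_one_lt hh hl)
      rwa [sub_add_sub_cancel] at this
    refine ⟨?_, fun j hj => (Nat.lt_succ_iff_lt_or_eq.1 hj).elim (h2 j) fun e => e ▸ hk⟩
    have := S.norm_Qstar_sub_eq hl hk (S.norm_fixed_sub_one_lt hh hl)
    rw [(hh lam hl).2, h1] at this
    rw [Function.iterate_succ_apply', this, pow_succ]
    ring

theorem norm_iterate_le_ϖ (S : PerturbationData p a rhat C ϖ ϑ) {lam : K}
    (hl : ‖lam - 1‖ < 1) {z : K} (hz : ‖z‖ ≤ ‖ϖ‖) (k : ℕ) : ‖(Qstar p a lam)^[k] z‖ ≤ ‖ϖ‖ := by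
  induction k with
  | zero => exact hz
  | succ k ih =>
    rw [Function.iterate_succ_apply']
    exact S.norm_Qstar_le_ϖ hl ih

theorem norm_iterate_le_mul_pow (S : PerturbationData p a rhat C ϖ ϑ) {lam : K}
    (hl : ‖lam - 1‖ < 1) {z : K} {u : ℝ} (hu : 1 ≤ u) (hz : ‖z‖ ≤ ‖ϖ‖ * u) {k : ℕ}
    (hk : ∀ j < k, ‖ϖ‖ * u ^ p ^ j ≤ 1) : ‖(Qstar p a lam)^[k] z‖ ≤ ‖ϖ‖ * u ^ p ^ k := by
  have hp := S.p_pos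
  induction k with
  | zero => simpa using hz
  | succ k ih =>
    have ih' := ih fun j hj => hk j (hj.trans k.lt_succ_self)
    rw [Function.iterate_succ_apply']
    refine (S.norm_Qstar_le hl (ih'.trans (hk k k.lt_succ_self))).trans (max_le ?_ ?_)
    · rw [← S.mul_mul_pow]
      gcongr
    · exact S.C_lt.le.trans (le_mul_of_one_le_right (norm_nonneg _) (one_le_pow₀ hu))

theorem norm_iterate_eq_mul_pow (S : PerturbationData p a rhat C ϖ ϑ) {lam : K}
    (hl : ‖lam - 1‖ < 1) {z : K} {u : ℝ} (hu : 1 < u) (hz : ‖z‖ = ‖ϖ‖ * u) {k : ℕ}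
    (hk : ∀ j < k, ‖ϖ‖ * u ^ p ^ j < 1) : ‖(Qstar p a lam)^[k] z‖ = ‖ϖ‖ * u ^ p ^ k := by
  induction k with
  | zero => simpa using hz
  | succ k ih =>
    have ih' := ih fun j hj => hk j (hj.trans k.lt_succ_self)
    have hgt : ‖ϖ‖ < ‖ϖ‖ * u ^ p ^ k := lt_mul_of_one_lt_right S.ϖ_pos
      (one_lt_pow₀ hu (pow_ne_zero _ S.prime.ne_zero))
    rw [Function.iterate_succ_apply', S.norm_Qstar_eq hl (by rwa [ih'])
      (by rw [ih']; exact hk k k.lt_succ_self), ih', S.mul_mul_pow]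

/-- Norms along an orbit segment in the open unit ball that reaches the unit sphere. -/
theorem norm_iterate_of_landing (S : PerturbationData p a rhat C ϖ ϑ) {lam : K}
    (hl : ‖lam - 1‖ < 1) {z : K} {m : ℕ} (hlt : ∀ k ≤ m, ‖(Qstar p a lam)^[k] z‖ < 1)
    (hland : ‖(Qstar p a lam)^[m + 1] z‖ = 1) :
    ‖(Qstar p a lam)^[m] z‖ = ‖ϑ‖ ∧
      ∀ k < m, ‖(Qstar p a lam)^[k] z‖ ≤ ‖ϑ‖ ∧ p * ‖(Qstar p a lam)^[k] z‖ ^ p ≤ ‖ϑ‖ := by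
  have hp := S.p_pos
  have hgt : ∀ k ≤ m, ‖ϖ‖ < ‖(Qstar p a lam)^[k] z‖ := by
    intro k hk
    by_contra! hle
    have := S.norm_iterate_le_ϖ hl hle (m + 1 - k)
    rw [← Function.iterate_add_apply, Nat.sub_add_cancel (by omega), hland] at this
    exact this.not_gt S.ϖ_lt_one
  have hstep : ∀ k ≤ m, ‖(Qstar p a lam)^[k + 1] z‖ = p * ‖(Qstar p a lam)^[k] z‖ ^ p := by
    intro k hk
    rw [Function.iterate_succ_apply']
    exact S.norm_Qstar_eq hl (hgt k hk) (hlt k hk)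
  have hm : ‖(Qstar p a lam)^[m] z‖ = ‖ϑ‖ := by
    have h1 := hstep m le_rfl
    rw [hland, ← S.norm_ϑ_pow] at h1
    exact ((pow_left_inj₀ (norm_nonneg _) (norm_nonneg _) S.prime.ne_zero).1
      (mul_left_cancel₀ hp.ne' h1)).symm
  have hle : ∀ k ≤ m, ‖(Qstar p a lam)^[k] z‖ ≤ ‖ϑ‖ := by
    intro k hk
    induction hk using Nat.decreasingInduction with
    | self => exact hm.le
    | of_succ k hk ih =>
      refine le_trans ?_ ih
      rw [hstep k hk.le]
      exact (S.lt_mul_pow (hgt k hk.le)).le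
  exact ⟨hm, fun k hk => ⟨hle k hk.le, by rw [← hstep k hk.le]; exact hle (k + 1) hk⟩⟩

end PerturbationData

theorem closedBall_subset_closedBall_of_mem {K : Type*} [PseudoMetricSpace K]
    [IsUltrametricDist K] {c c' : K} {r r' : ℝ} (hc : c' ∈ closedBall c r) (hr : r' ≤ r) :
    closedBall c' r' ⊆ closedBall c r := by
  rw [IsUltrametricDist.closedBall_eq_of_mem hc]
  exact closedBall_subset_closedBall hr

namespace PerturbationData

variable {K : Type*} [NontriviallyNormedField K]
  {p : ℕ} {a : ℕ → K} {rhat C : ℝ} {ϖ ϑ : K} {h : K → K}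

theorem inv_p_pos (S : PerturbationData p a rhat C ϖ ϑ) : 0 < (p : ℝ)⁻¹ := inv_pos.2 S.p_pos

theorem inv_pow_le_inv_pow (S : PerturbationData p a rhat C ϖ ϑ) {m n : ℕ} (hmn : m ≤ n) :
    (p : ℝ)⁻¹ ^ n ≤ (p : ℝ)⁻¹ ^ m :=
  pow_le_pow_of_le_one S.inv_p_pos.le S.inv_lt_one.le hmn

theorem inv_pow_lt_inv_pow (S : PerturbationData p a rhat C ϖ ϑ) {m n : ℕ} (hmn : m < n) :
    (p : ℝ)⁻¹ ^ n < (p : ℝ)⁻¹ ^ m :=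
  pow_lt_pow_right_of_lt_one₀ S.inv_p_pos S.inv_lt_one hmn

theorem inv_pow_lt_one (S : PerturbationData p a rhat C ϖ ϑ) {n : ℕ} (hn : n ≠ 0) :
    (p : ℝ)⁻¹ ^ n < 1 :=
  pow_lt_one₀ S.inv_p_pos.le S.inv_lt_one hn

theorem inv_sq_lt_ϑ (S : PerturbationData p a rhat C ϖ ϑ) : (p : ℝ)⁻¹ ^ 2 < ‖ϑ‖ := by
  have := S.inv_pow_lt_inv_pow one_lt_two
  rw [pow_one] at this
  exact this.trans_le S.inv_le_ϑ

theorem mul_inv_sq_pow_le (S : PerturbationData p a rhat C ϖ ϑ) :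
    p * ((p : ℝ)⁻¹ ^ 2) ^ p ≤ ‖ϑ‖ := by
  have hp := S.p_pos
  calc p * ((p : ℝ)⁻¹ ^ 2) ^ p ≤ p * (p : ℝ)⁻¹ ^ 2 := by
        gcongr
        exact pow_le_of_le_one (by positivity) (S.inv_pow_lt_one two_ne_zero).le S.prime.ne_zero
    _ = (p : ℝ)⁻¹ := by field_simp
    _ ≤ ‖ϑ‖ := S.inv_le_ϑ

/-- The orbit of `z` spends `m` steps in the small disc around `0` and is then mapped to the unit
sphere. -/
def IsLanding (p : ℕ) (a : ℕ → K) (ϑ lam : K) (m : ℕ) (z : K) : Prop :=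
  ‖(Qstar p a lam)^[m] z‖ = ‖ϑ‖ ∧
    ∀ k < m, ‖(Qstar p a lam)^[k] z‖ ≤ ‖ϑ‖ ∧ p * ‖(Qstar p a lam)^[k] z‖ ^ p ≤ ‖ϑ‖

theorem IsLanding.norm_iterate_le {lam z : K} {m : ℕ} (H : IsLanding p a ϑ lam m z) {k : ℕ}
    (hk : k ≤ m) : ‖(Qstar p a lam)^[k] z‖ ≤ ‖ϑ‖ :=
  hk.lt_or_eq.elim (fun hk => (H.2 k hk).1) fun e => by rw [e]; exact H.1.le

variable [IsUltrametricDist K]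

theorem norm_sub_one_lt_of_mem (S : PerturbationData p a rhat C ϖ ϑ) {c lam : K}
    (hc : ‖c - 1‖ < 1) {n : ℕ} (hn : n ≠ 0) (hl : lam ∈ closedBall c ((p : ℝ)⁻¹ ^ n)) :
    ‖lam - 1‖ < 1 := by
  rw [mem_closedBall, dist_eq_norm] at hl
  have := norm_add_lt_of_lt_of_lt (hl.trans_lt (S.inv_pow_lt_one hn)) hc
  rwa [sub_add_sub_cancel] at this

theorem norm_iterate_sub_param_eq [CompleteSpace K] (S : PerturbationData p a rhat C ϖ ϑ)
    {lam lam' : K} (hl : ‖lam - 1‖ < 1) {z w : K} (hzw : ‖z - w‖ = ‖lam - lam'‖) {k : ℕ}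
    (hz : ∀ j < k, ‖(Qstar p a lam)^[j] z - 1‖ < 1)
    (hw : ∀ j < k, ‖(Qstar p a lam')^[j] w - 1‖ < 1) :
    ‖(Qstar p a lam)^[k] z - (Qstar p a lam')^[k] w‖ = p ^ k * ‖lam - lam'‖ := by
  rcases eq_or_ne lam lam' with rfl | hne
  · rw [S.norm_iterate_sub_eq hl hz hw, hzw]
  have hpos : 0 < ‖lam - lam'‖ := norm_pos_iff.2 (sub_ne_zero.2 hne)
  have hp := S.p_pos
  induction k with
  | zero => simpa using hzw
  | succ k ih =>
    have ih' := ih (fun j hj => hz j (hj.trans k.lt_succ_self))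
      (fun j hj => hw j (hj.trans k.lt_succ_self))
    have hwk := hw k k.lt_succ_self
    rw [Function.iterate_succ_apply', Function.iterate_succ_apply']
    set x := (Qstar p a lam)^[k] z
    set y := (Qstar p a lam')^[k] w
    have h1 := S.norm_Qstar_sub_eq hl (hz k k.lt_succ_self) hwk
    have h2 := S.norm_Qstar_sub_param lam lam' y
    rw [norm_eq_one_of_norm_sub_one_lt hwk, one_pow, mul_one, norm_sub_rev 1] at h2
    have hlt : ‖Qstar p a lam y - Qstar p a lam' y‖ < ‖Qstar p a lam x - Qstar p a lam y‖ := by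
      rw [h1, h2, ih']
      have h3 : (1 : ℝ) ≤ p ^ k := one_le_pow₀ (by linarith [S.two_le])
      calc p * ‖y - 1‖ * ‖lam - lam'‖ < p * 1 * ‖lam - lam'‖ := by gcongr
        _ ≤ p * p ^ k * ‖lam - lam'‖ := by gcongr
        _ = _ := mul_assoc _ _ _
    have := norm_add_eq_left_of_lt hlt
    rw [sub_add_sub_cancel] at this
    rw [this, h1, ih', pow_succ]
    ring

theorem norm_Qstar_sub_param_le [CompleteSpace K] (S : PerturbationData p a rhat C ϖ ϑ)
    {lam lam' : K} (hl : ‖lam - 1‖ < 1) {z w : K} {s b : ℝ} (hz : ‖z‖ ≤ s) (hw : ‖w‖ ≤ s)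
    (hs : s ≤ ‖ϑ‖) (hzw : ‖z - w‖ ≤ ((p : ℝ)⁻¹) ^ 2) (hsb : p * s ^ p ≤ b) (hb : ‖ϑ‖ ≤ b) :
    ‖Qstar p a lam z - Qstar p a lam' w‖ ≤ b * max ‖z - w‖ ‖lam - lam'‖ := by
  have hp := S.p_pos
  have hb0 : 0 ≤ b := (norm_nonneg _).trans hb
  have hs0 : 0 ≤ s := (norm_nonneg _).trans hz
  rw [← sub_add_sub_cancel _ (Qstar p a lam w)]
  refine norm_add_le_of_le_of_le ((S.norm_Qstar_sub_le hl hz hw hs hzw hsb hb).trans ?_) ?_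
  · gcongr
    exact le_max_left _ _
  · rw [S.norm_Qstar_sub_param]
    have h1 : ‖1 - w‖ ≤ 1 := norm_one_sub_le (hw.trans (hs.trans S.ϑ_lt_one.le))
    calc p * ‖w‖ ^ p * ‖1 - w‖ * ‖lam - lam'‖ ≤ p * s ^ p * 1 * ‖lam - lam'‖ := by gcongr
      _ ≤ b * max ‖z - w‖ ‖lam - lam'‖ := by
        rw [mul_one]
        gcongr
        exact le_max_right _ _

theorem norm_iterate_sub_landing_le [CompleteSpace K] (S : PerturbationData p a rhat C ϖ ϑ)
    {lam lam₀ z w : K} (hl : ‖lam - 1‖ < 1) {m : ℕ} (H : IsLanding p a ϑ lam₀ m z)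
    (hll : ‖lam - lam₀‖ ≤ (p : ℝ)⁻¹ ^ 2) (hw : ‖w - z‖ ≤ (p : ℝ)⁻¹ ^ 2) {k : ℕ} (hk : k ≤ m) :
    ‖(Qstar p a lam)^[k] w - (Qstar p a lam₀)^[k] z‖ ≤ (p : ℝ)⁻¹ ^ 2 := by
  have hp := S.p_pos
  induction k with
  | zero => exact hw
  | succ k ih =>
    have ih' := ih (by omega)
    obtain ⟨h1, h2⟩ := H.2 k hk
    rw [Function.iterate_succ_apply', Function.iterate_succ_apply']
    set x := (Qstar p a lam)^[k] w
    set y := (Qstar p a lam₀)^[k] z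
    have hx : ‖x‖ ≤ max ‖y‖ ((p : ℝ)⁻¹ ^ 2) := by
      have := norm_add_le_of_le_of_le (ih'.trans (le_max_right ‖y‖ _)) (le_max_left ‖y‖ _)
      rwa [sub_add_cancel] at this
    refine (S.norm_Qstar_sub_param_le hl hx (le_max_left _ _) (max_le h1 S.inv_sq_lt_ϑ.le) ih'
      (b := ‖ϑ‖) ?_ le_rfl).trans ?_
    · rcases max_choice ‖y‖ ((p : ℝ)⁻¹ ^ 2) with e | e <;> rw [e]
      exacts [h2, S.mul_inv_sq_pow_le]
    · exact (mul_le_of_le_one_left (le_max_of_le_left (norm_nonneg _)) S.ϑ_lt_one.le).trans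
        (max_le ih' hll)

theorem isLanding_of_close [CompleteSpace K] (S : PerturbationData p a rhat C ϖ ϑ)
    {lam lam₀ z w : K} (hl : ‖lam - 1‖ < 1) {m : ℕ} (H : IsLanding p a ϑ lam₀ m z)
    (hll : ‖lam - lam₀‖ ≤ (p : ℝ)⁻¹ ^ 2) (hw : ‖w - z‖ ≤ (p : ℝ)⁻¹ ^ 2) :
    IsLanding p a ϑ lam m w := by
  have hp := S.p_pos
  refine ⟨?_, fun k hk => ?_⟩
  · rw [← H.1]
    refine norm_eq_of_norm_sub_lt_left ?_
    rw [H.1]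
    exact (S.norm_iterate_sub_landing_le hl H hll hw le_rfl).trans_lt S.inv_sq_lt_ϑ
  · obtain ⟨h1, h2⟩ := H.2 k hk
    have hx : ‖(Qstar p a lam)^[k] w‖ ≤ max ‖(Qstar p a lam₀)^[k] z‖ ((p : ℝ)⁻¹ ^ 2) := by
      have := norm_add_le_of_le_of_le ((S.norm_iterate_sub_landing_le hl H hll hw hk.le).trans
        (le_max_right ‖(Qstar p a lam₀)^[k] z‖ _)) (le_max_left ‖(Qstar p a lam₀)^[k] z‖ _)
      rwa [sub_add_cancel] at this
    refine ⟨hx.trans (max_le h1 S.inv_sq_lt_ϑ.le), ?_⟩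
    calc p * ‖(Qstar p a lam)^[k] w‖ ^ p
        ≤ p * (max ‖(Qstar p a lam₀)^[k] z‖ ((p : ℝ)⁻¹ ^ 2)) ^ p := by gcongr
      _ ≤ ‖ϑ‖ := by
        rcases max_choice ‖(Qstar p a lam₀)^[k] z‖ ((p : ℝ)⁻¹ ^ 2) with e | e <;> rw [e]
        exacts [h2, S.mul_inv_sq_pow_le]

/-- Contraction estimate along an orbit segment near `0`, uniform in the parameter. -/
theorem norm_iterate_sub_param_le [CompleteSpace K] (S : PerturbationData p a rhat C ϖ ϑ)
    {lam lam' z w : K} (hl : ‖lam - 1‖ < 1) {m : ℕ} (H : IsLanding p a ϑ lam' m w)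
    (hll : ‖lam - lam'‖ ≤ (p : ℝ)⁻¹ ^ 2) (hzw : ‖z - w‖ ≤ (p : ℝ)⁻¹ ^ 2) {k : ℕ} (hk : k ≤ m) :
    ‖(Qstar p a lam)^[k] z - (Qstar p a lam')^[k] w‖ ≤
      max (‖ϑ‖ ^ k * ‖z - w‖) (‖ϑ‖ * ‖lam - lam'‖) := by
  have hp := S.p_pos
  have H' := S.isLanding_of_close hl H hll hzw
  induction k with
  | zero => simp
  | succ k ih =>
    have ih' := ih (by omega)
    have hclose := S.norm_iterate_sub_landing_le hl H hll hzw (k := k) (by omega)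
    obtain ⟨h1, h2⟩ := H.2 k hk
    obtain ⟨h1', h2'⟩ := H'.2 k hk
    rw [Function.iterate_succ_apply', Function.iterate_succ_apply']
    set x := (Qstar p a lam)^[k] z
    set y := (Qstar p a lam')^[k] w
    refine (S.norm_Qstar_sub_param_le hl (le_max_left ‖x‖ ‖y‖) (le_max_right _ _) (max_le h1' h1)
      hclose (b := ‖ϑ‖) ?_ le_rfl).trans ?_
    · rcases max_choice ‖x‖ ‖y‖ with e | e <;> rw [e]
      exacts [h2', h2]
    · rw [mul_max_of_nonneg _ _ (norm_nonneg _), pow_succ', mul_assoc]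
      refine max_le ?_ (le_max_right _ _)
      calc ‖ϑ‖ * ‖x - y‖ ≤ ‖ϑ‖ * max (‖ϑ‖ ^ k * ‖z - w‖) (‖ϑ‖ * ‖lam - lam'‖) := by gcongr
        _ = max (‖ϑ‖ * (‖ϑ‖ ^ k * ‖z - w‖)) (‖ϑ‖ * (‖ϑ‖ * ‖lam - lam'‖)) :=
          mul_max_of_nonneg _ _ (norm_nonneg _)
        _ ≤ _ := by
          refine max_le_max le_rfl ?_
          exact mul_le_of_le_one_left (by positivity) S.ϑ_lt_one.le

end PerturbationData

namespace PerturbationData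

variable {K : Type*} [NontriviallyNormedField K] {p : ℕ} {a : ℕ → K} {rhat C : ℝ} {ϖ ϑ : K}
  {h : K → K}

theorem inv_lt_ϑ (S : PerturbationData p a rhat C ϖ ϑ) : (p : ℝ)⁻¹ < ‖ϑ‖ := by
  have h : ‖ϑ‖ ^ p = (p : ℝ)⁻¹ := eq_inv_of_mul_eq_one_right S.norm_ϑ_pow
  rw [← h]
  exact pow_lt_self_of_lt_one₀ S.ϑ_pos S.ϑ_lt_one S.prime.one_lt

theorem pow_mul_inv_pow (S : PerturbationData p a rhat C ϖ ϑ) (n : ℕ) :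
    (p : ℝ) ^ n * (p : ℝ)⁻¹ ^ n = 1 := by
  rw [← mul_pow, mul_inv_cancel₀ S.p_pos.ne', one_pow]

theorem norm_p_pow (S : PerturbationData p a rhat C ϖ ϑ) (n : ℕ) :
    ‖(p : K) ^ n‖ = (p : ℝ)⁻¹ ^ n := by
  rw [norm_pow, S.norm_p]

theorem exists_ladder [IsAlgClosed K] (S : PerturbationData p a rhat C ϖ ϑ) (m : ℕ) :
    ∃ γ : K, 1 < ‖γ‖ ∧ (∀ j ≤ m, ‖ϖ‖ * ‖γ‖ ^ p ^ j < 1) ∧ 1 < ‖ϖ‖ * ‖γ‖ ^ p ^ (m + 1) := by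
  have h0 := S.ϖ_pos
  have h1 := S.ϖ_lt_one
  obtain ⟨γ, hγ⟩ := IsAlgClosed.exists_pow_nat_eq (ϖ⁻¹ ^ 2)
    (Nat.mul_pos three_pos (pow_pos S.prime.pos m))
  have hv : (‖γ‖ ^ p ^ m) ^ 3 = ‖ϖ‖⁻¹ ^ 2 := by
    rw [← pow_mul, mul_comm, ← norm_pow, hγ, norm_pow, norm_inv]
  have hv1 : 1 < ‖γ‖ ^ p ^ m := by
    refine lt_of_pow_lt_pow_left₀ 3 (by positivity) ?_
    rw [hv, one_pow]
    exact one_lt_pow₀ ((one_lt_inv₀ h0).2 h1) two_ne_zero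
  have hγ1 : 1 < ‖γ‖ := by
    by_contra! hle
    exact hv1.not_ge (pow_le_one₀ (norm_nonneg _) hle)
  refine ⟨γ, hγ1, fun j hj => ?_, ?_⟩
  · refine lt_of_le_of_lt (mul_le_mul_of_nonneg_left
      (pow_le_pow_right₀ hγ1.le (pow_le_pow_right₀ S.prime.one_le hj)) h0.le) ?_
    refine lt_of_pow_lt_pow_left₀ 3 zero_le_one ?_
    rw [mul_pow, hv, one_pow, inv_pow]
    calc ‖ϖ‖ ^ 3 * (‖ϖ‖ ^ 2)⁻¹ = ‖ϖ‖ := by field_simp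
      _ < 1 := h1
  · rw [pow_succ, pow_mul]
    refine lt_of_lt_of_le ?_ (mul_le_mul_of_nonneg_left
      (pow_le_pow_right₀ hv1.le S.prime.two_le) h0.le)
    refine lt_of_pow_lt_pow_left₀ 3 (by positivity) ?_
    rw [mul_pow, ← pow_mul, mul_comm 2 3, pow_mul, hv, one_pow, inv_pow]
    calc 1 < ‖ϖ‖⁻¹ := (one_lt_inv₀ h0).2 h1
      _ = ‖ϖ‖ ^ 3 * ((‖ϖ‖ ^ 2)⁻¹) ^ 2 := by field_simp

/-- The marked point after leaving the fixed point near `1` and visiting a neighborhood of `0`. -/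
noncomputable def nextPoint (p : ℕ) (a : ℕ → K) (n : ℕ) (W : K → K) (lam : K) : K :=
  (Qstar p a lam)^[p * (n + 4) + 1] ((Qstar p a lam)^[n + 1] (W lam))

theorem mem_of_mem_inv_mul (S : PerturbationData p a rhat C ϖ ϑ) {c lam : K} {n : ℕ}
    (hl : lam ∈ closedBall c (‖ϑ‖⁻¹ * (p : ℝ)⁻¹ ^ (n + 1))) :
    lam ∈ closedBall c ((p : ℝ)⁻¹ ^ n) := by
  refine closedBall_subset_closedBall ?_ hl
  have := S.inv_p_pos
  rw [inv_mul_le_iff₀ S.ϑ_pos, pow_succ']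
  gcongr
  exact S.inv_le_ϑ

variable [IsUltrametricDist K]

theorem polyApprox_iterate [CompleteSpace K] (S : PerturbationData p a rhat C ϖ ϑ) {D : Set K}
    (hD : Bornology.IsBounded D) {F : K → K} (hF : PolyApprox D F) {N : ℕ}
    (hF1 : ∀ k < N, ∀ lam ∈ D, ‖(Qstar p a lam)^[k] (F lam)‖ ≤ 1) :
    PolyApprox D fun lam => (Qstar p a lam)^[N] (F lam) := by
  induction N with
  | zero => exact hF
  | succ N ih =>
    refine (S.polyApprox_Qstar hD (PolyApprox.id _) (ih fun k hk => hF1 k (hk.trans N.lt_succ_self))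
      (hF1 N N.lt_succ_self)).congr fun lam _ => ?_
    rw [Function.iterate_succ_apply']

/-- A ball of parameters of radius `p⁻¹ ^ n` on which the marked orbit point `W λ` is an isometric
function of `λ`, and lands near the fixed point at the center. -/
structure Stage (p : ℕ) (h : K → K) (n : ℕ) (c : K) (W : K → K) : Prop where
  center : ‖c - 1‖ < 1
  approx : PolyApprox (closedBall c ((p : ℝ)⁻¹ ^ n)) W
  iso : ∀ lam ∈ closedBall c ((p : ℝ)⁻¹ ^ n), ∀ lam' ∈ closedBall c ((p : ℝ)⁻¹ ^ n),
    ‖W lam - W lam'‖ = ‖lam - lam'‖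
  land : ‖W c - h c‖ < (p : ℝ)⁻¹ ^ (n + 1)

section Stage

variable [CompleteSpace K] {n : ℕ} {c : K} {W : K → K}

theorem Stage.near_one (St : Stage p h n c W) (S : PerturbationData p a rhat C ϖ ϑ)
    (hh : IsFixedPointNearOne p a h) (hn : n ≠ 0) {lam : K}
    (hl : lam ∈ closedBall c (‖ϑ‖⁻¹ * (p : ℝ)⁻¹ ^ (n + 1))) :
    ‖(Qstar p a lam)^[n + 1] (W lam) - h lam‖ = p ^ (n + 1) * ‖W lam - h lam‖ ∧
      ∀ k < n + 1, ‖(Qstar p a lam)^[k] (W lam) - 1‖ < 1 := by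
  have hq := S.inv_p_pos
  have hp := S.p_pos
  have hl' := S.mem_of_mem_inv_mul hl
  have hc : c ∈ closedBall c ((p : ℝ)⁻¹ ^ n) := mem_closedBall_self (by positivity)
  have hΛ := S.norm_sub_one_lt_of_mem St.center hn hl'
  refine S.norm_iterate_sub_fixed hh hΛ ?_
  have hθ : 1 ≤ ‖ϑ‖⁻¹ := (one_le_inv₀ S.ϑ_pos).2 S.ϑ_lt_one.le
  have hd : ‖lam - c‖ ≤ ‖ϑ‖⁻¹ * (p : ℝ)⁻¹ ^ (n + 1) := by
    rwa [mem_closedBall, dist_eq_norm] at hl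
  have hle : ‖W lam - h lam‖ ≤ ‖ϑ‖⁻¹ * (p : ℝ)⁻¹ ^ (n + 1) := by
    have e : W lam - h lam = (W lam - W c) + ((W c - h c) - (h lam - h c)) := by ring
    rw [e]
    refine norm_add_le_of_le_of_le ?_ (norm_sub_le_of_le_of_le ?_ ?_)
    · rwa [St.iso _ hl' _ hc]
    · exact St.land.le.trans (le_mul_of_one_le_left (by positivity) hθ)
    · refine (S.norm_fixed_sub_le hh hΛ St.center).trans ?_
      exact (mul_le_of_le_one_left (norm_nonneg _) S.ϑ_lt_one.le).trans hd
  calc p ^ (n + 1) * ‖W lam - h lam‖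
      ≤ p ^ (n + 1) * (‖ϑ‖⁻¹ * (p : ℝ)⁻¹ ^ (n + 1)) := by gcongr
    _ = ‖ϑ‖⁻¹ * (p ^ (n + 1) * (p : ℝ)⁻¹ ^ (n + 1)) := by ring
    _ = ‖ϑ‖⁻¹ := by rw [S.pow_mul_inv_pow, mul_one]
    _ < p := inv_lt_of_inv_lt₀ hp S.inv_lt_ϑ

theorem Stage.norm_exit_sub_eq (St : Stage p h n c W) (S : PerturbationData p a rhat C ϖ ϑ)
    (hh : IsFixedPointNearOne p a h) (hn : n ≠ 0) {lam lam' : K}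
    (hl : lam ∈ closedBall c (‖ϑ‖⁻¹ * (p : ℝ)⁻¹ ^ (n + 1)))
    (hl' : lam' ∈ closedBall c (‖ϑ‖⁻¹ * (p : ℝ)⁻¹ ^ (n + 1))) :
    ‖(Qstar p a lam)^[n + 1] (W lam) - (Qstar p a lam')^[n + 1] (W lam')‖ =
      p ^ (n + 1) * ‖lam - lam'‖ :=
  S.norm_iterate_sub_param_eq
    (S.norm_sub_one_lt_of_mem St.center hn (S.mem_of_mem_inv_mul hl))
    (St.iso _ (S.mem_of_mem_inv_mul hl) _ (S.mem_of_mem_inv_mul hl'))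
    (St.near_one S hh hn hl).2 (St.near_one S hh hn hl').2

theorem Stage.polyApprox_exit (St : Stage p h n c W) (S : PerturbationData p a rhat C ϖ ϑ)
    (hh : IsFixedPointNearOne p a h) (hn : n ≠ 0) :
    PolyApprox (closedBall c (‖ϑ‖⁻¹ * (p : ℝ)⁻¹ ^ (n + 1)))
      fun lam => (Qstar p a lam)^[n + 1] (W lam) :=
  S.polyApprox_iterate isBounded_closedBall (St.approx.mono fun _ => S.mem_of_mem_inv_mul)
    fun k hk _ hl => (norm_eq_one_of_norm_sub_one_lt ((St.near_one S hh hn hl).2 k hk)).le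

/-- Some parameter sends the marked point close to `0`. -/
theorem Stage.exists_norm_exit_le [IsAlgClosed K] (St : Stage p h n c W)
    (S : PerturbationData p a rhat C ϖ ϑ) (hh : IsFixedPointNearOne p a h) (hn : n ≠ 0) :
    ∃ lam ∈ closedBall c (‖ϑ‖⁻¹ * (p : ℝ)⁻¹ ^ (n + 1)),
      ‖(Qstar p a lam)^[n + 1] (W lam)‖ ≤ ‖ϖ‖ := by
  have hq := S.inv_p_pos
  have hp := S.p_pos
  have hθ := S.ϑ_pos
  have hθ1 : 1 < ‖ϑ‖⁻¹ := (one_lt_inv₀ S.ϑ_pos).2 S.ϑ_lt_one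
  have hc : c ∈ closedBall c (‖ϑ‖⁻¹ * (p : ℝ)⁻¹ ^ (n + 1)) := mem_closedBall_self (by positivity)
  have hd : ‖c + p ^ (n + 1) * ϑ⁻¹ - c‖ = ‖ϑ‖⁻¹ * (p : ℝ)⁻¹ ^ (n + 1) := by
    rw [add_sub_cancel_left, norm_mul, S.norm_p_pow, norm_inv, mul_comm]
  have hc' : c + p ^ (n + 1) * ϑ⁻¹ ∈ closedBall c (‖ϑ‖⁻¹ * (p : ℝ)⁻¹ ^ (n + 1)) := by
    rw [mem_closedBall, dist_eq_norm, hd]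
  have h1 : ‖(Qstar p a c)^[n + 1] (W c)‖ = 1 := by
    refine norm_eq_one_of_norm_sub_one_lt ?_
    rw [← sub_add_sub_cancel _ (h c)]
    refine norm_add_lt_of_lt_of_lt ?_ (S.norm_fixed_sub_one_lt hh St.center)
    rw [(St.near_one S hh hn hc).1, ← S.pow_mul_inv_pow (n + 1)]
    have := St.land
    gcongr
  have h2 := St.norm_exit_sub_eq S hh hn hc' hc
  rw [hd, mul_left_comm, S.pow_mul_inv_pow, mul_one] at h2
  have h3 := norm_add_eq_left_of_lt
    (x := (Qstar p a (c + p ^ (n + 1) * ϑ⁻¹))^[n + 1] (W (c + p ^ (n + 1) * ϑ⁻¹)) -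
      (Qstar p a c)^[n + 1] (W c)) (y := (Qstar p a c)^[n + 1] (W c)) (by rwa [h1, h2])
  rw [sub_add_cancel, h2] at h3
  exact (St.polyApprox_exit S hh hn).exists_norm_le_of_norm_ne hc hc'
    (by rw [h1, h3]; exact hθ1.ne) S.ϖ_pos

/-- Some parameter makes the marked point follow the prescribed itinerary and land near the fixed
point again. -/
theorem Stage.exists_land [IsAlgClosed K] (St : Stage p h n c W)
    (S : PerturbationData p a rhat C ϖ ϑ) (hh : IsFixedPointNearOne p a h) (hn : n ≠ 0)
    (m : ℕ) {τ : ℝ} (hτ : 0 < τ) (hτ1 : τ < 1) :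
    ∃ c' ∈ closedBall c (‖ϑ‖⁻¹ * (p : ℝ)⁻¹ ^ (n + 1)),
      ‖(Qstar p a c')^[m + 1] ((Qstar p a c')^[n + 1] (W c')) - h c'‖ ≤ τ ∧
      IsLanding p a ϑ c' m ((Qstar p a c')^[n + 1] (W c')) := by
  have hq := S.inv_p_pos
  have hp := S.p_pos
  have hϖ := S.ϖ_pos
  have hθ := S.ϑ_pos
  have hθ1 : 1 < ‖ϑ‖⁻¹ := (one_lt_inv₀ S.ϑ_pos).2 S.ϑ_lt_one
  obtain ⟨l₀, hl₀, hsmall⟩ := St.exists_norm_exit_le S hh hn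
  obtain ⟨γ, hγ, hlow, hhigh⟩ := S.exists_ladder m
  have ht : ‖ϖ‖ * ‖γ‖ < 1 := by simpa using hlow 0 (Nat.zero_le m)
  have hϖt : ‖ϖ‖ < ‖ϖ‖ * ‖γ‖ := lt_mul_of_one_lt_right hϖ hγ
  set r : ℝ := ‖ϖ‖ * ‖γ‖ * (p : ℝ)⁻¹ ^ (n + 1) with hr
  have hsub : closedBall l₀ r ⊆ closedBall c (‖ϑ‖⁻¹ * (p : ℝ)⁻¹ ^ (n + 1)) :=
    closedBall_subset_closedBall_of_mem hl₀ (by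
      rw [hr]
      gcongr
      exact ht.le.trans hθ1.le)
  have hΛ : ∀ lam ∈ closedBall l₀ r, ‖lam - 1‖ < 1 := fun lam hl =>
    S.norm_sub_one_lt_of_mem St.center hn (S.mem_of_mem_inv_mul (hsub hl))
  have hpr : (p : ℝ) ^ (n + 1) * r = ‖ϖ‖ * ‖γ‖ := by
    rw [hr, mul_left_comm, S.pow_mul_inv_pow, mul_one]
  have hself : l₀ ∈ closedBall l₀ r := mem_closedBall_self (by positivity)
  have hZ : ∀ lam ∈ closedBall l₀ r, ‖(Qstar p a lam)^[n + 1] (W lam)‖ ≤ ‖ϖ‖ * ‖γ‖ := by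
    intro lam hl
    rw [← sub_add_cancel ((Qstar p a lam)^[n + 1] (W lam)) ((Qstar p a l₀)^[n + 1] (W l₀))]
    refine norm_add_le_of_le_of_le ?_ (hsmall.trans hϖt.le)
    rw [St.norm_exit_sub_eq S hh hn (hsub hl) hl₀, ← hpr]
    rw [mem_closedBall, dist_eq_norm] at hl
    gcongr
  have hlt : ∀ lam ∈ closedBall l₀ r, ∀ k ≤ m,
      ‖(Qstar p a lam)^[k] ((Qstar p a lam)^[n + 1] (W lam))‖ < 1 := fun lam hl k hk =>
    (S.norm_iterate_le_mul_pow (hΛ lam hl) hγ.le (hZ lam hl)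
      fun j hj => (hlow j (hj.le.trans hk)).le).trans_lt (hlow k hk)
  have hF : PolyApprox (closedBall l₀ r) fun lam =>
      (Qstar p a lam)^[m + 1] ((Qstar p a lam)^[n + 1] (W lam)) - h lam := by
    refine (S.polyApprox_iterate isBounded_closedBall ((St.polyApprox_exit S hh hn).mono hsub)
      fun k hk lam hl => (hlt lam hl k (Nat.lt_succ_iff.1 hk)).le).sub isBounded_closedBall ?_
    refine S.polyApprox_fixed hh (hΛ _ hself) ?_
    calc r ≤ 1 * (p : ℝ)⁻¹ ^ (n + 1) := by rw [hr]; gcongr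
      _ ≤ (p : ℝ)⁻¹ := by
        rw [one_mul]
        exact pow_le_of_le_one hq.le S.inv_lt_one.le n.succ_ne_zero
  have hh1 : ∀ lam ∈ closedBall l₀ r, ‖h lam‖ = 1 := fun lam hl =>
    norm_eq_one_of_norm_sub_one_lt (S.norm_fixed_sub_one_lt hh (hΛ lam hl))
  have hval₀ : ‖(Qstar p a l₀)^[m + 1] ((Qstar p a l₀)^[n + 1] (W l₀)) - h l₀‖ = 1 := by
    rw [norm_sub_rev, sub_eq_add_neg, norm_add_eq_left_of_lt, hh1 _ hself]
    rw [hh1 _ hself, norm_neg]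
    exact (S.norm_iterate_le_ϖ (hΛ _ hself) hsmall _).trans_lt S.ϖ_lt_one
  set l₁ : K := l₀ + p ^ (n + 1) * (ϖ * γ) with hl₁def
  have hd : ‖l₁ - l₀‖ = r := by
    rw [hl₁def, add_sub_cancel_left, norm_mul, S.norm_p_pow, norm_mul, mul_comm]
  have hl₁ : l₁ ∈ closedBall l₀ r := by rw [mem_closedBall, dist_eq_norm, hd]
  have hZ₁ : ‖(Qstar p a l₁)^[n + 1] (W l₁)‖ = ‖ϖ‖ * ‖γ‖ := by
    have h2 := St.norm_exit_sub_eq S hh hn (hsub hl₁) hl₀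
    rw [hd, hpr] at h2
    have h3 := norm_add_eq_left_of_lt (x := (Qstar p a l₁)^[n + 1] (W l₁) -
      (Qstar p a l₀)^[n + 1] (W l₀)) (y := (Qstar p a l₀)^[n + 1] (W l₀))
      (by rw [h2]; exact hsmall.trans_lt hϖt)
    rwa [sub_add_cancel, h2] at h3
  have hval₁ : 1 < ‖(Qstar p a l₁)^[m + 1] ((Qstar p a l₁)^[n + 1] (W l₁)) - h l₁‖ := by
    have h2 := S.norm_iterate_eq_mul_pow (hΛ _ hl₁) hγ hZ₁ (k := m + 1)
      fun j hj => hlow j (Nat.lt_succ_iff.1 hj)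
    rw [sub_eq_add_neg, norm_add_eq_left_of_lt, h2]
    · exact hhigh
    · rw [h2, norm_neg, hh1 _ hl₁]
      exact hhigh
  obtain ⟨c', hc', hland⟩ := hF.exists_norm_le_of_norm_ne hself hl₁
    (by rw [hval₀]; exact hval₁.ne) hτ
  refine ⟨c', hsub hc', hland, S.norm_iterate_of_landing (hΛ _ hc') (hlt c' hc') ?_⟩
  rw [← hh1 c' hc']
  refine norm_eq_of_norm_sub_lt_left ?_
  rw [hh1 c' hc']
  exact hland.trans_lt hτ1

/-- The inductive step of the construction of the parameter. -/
theorem Stage.exists_next [IsAlgClosed K] (St : Stage p h n c W)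
    (S : PerturbationData p a rhat C ϖ ϑ) (hh : IsFixedPointNearOne p a h) (hn : n ≠ 0) :
    ∃ c' ∈ closedBall c ((p : ℝ)⁻¹ ^ n), Stage p h (n + 3) c' (nextPoint p a n W) ∧
      ∀ lam ∈ closedBall c' ((p : ℝ)⁻¹ ^ (n + 3)),
        (∀ k < n + 1, ‖(Qstar p a lam)^[k] (W lam) - 1‖ < 1) ∧
        IsLanding p a ϑ lam (p * (n + 4)) ((Qstar p a lam)^[n + 1] (W lam)) := by
  have hq := S.inv_p_pos
  have hp := S.p_pos
  have hθ := S.ϑ_pos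
  have hθ1 : 1 < ‖ϑ‖⁻¹ := (one_lt_inv₀ S.ϑ_pos).2 S.ϑ_lt_one
  obtain ⟨c', hc', hland, hL⟩ := St.exists_land S hh hn (p * (n + 4))
    (pow_pos hq (n + 5)) (S.inv_pow_lt_one (by omega))
  have hsub : closedBall c' ((p : ℝ)⁻¹ ^ (n + 3)) ⊆
      closedBall c (‖ϑ‖⁻¹ * (p : ℝ)⁻¹ ^ (n + 1)) :=
    closedBall_subset_closedBall_of_mem hc' ((S.inv_pow_le_inv_pow (by omega)).trans
      (le_mul_of_one_le_left (by positivity) hθ1.le))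
  have hself : c' ∈ closedBall c' ((p : ℝ)⁻¹ ^ (n + 3)) := mem_closedBall_self (by positivity)
  have hΛ : ∀ lam ∈ closedBall c' ((p : ℝ)⁻¹ ^ (n + 3)), ‖lam - 1‖ < 1 := fun lam hl =>
    S.norm_sub_one_lt_of_mem St.center hn (S.mem_of_mem_inv_mul (hsub hl))
  have hmul : (p : ℝ) ^ (n + 1) * (p : ℝ)⁻¹ ^ (n + 3) = (p : ℝ)⁻¹ ^ 2 := by
    rw [show n + 3 = (n + 1) + 2 by ring, pow_add _ (n + 1), ← mul_assoc, S.pow_mul_inv_pow,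
      one_mul]
  have hdist : ∀ lam ∈ closedBall c' ((p : ℝ)⁻¹ ^ (n + 3)),
      ∀ lam' ∈ closedBall c' ((p : ℝ)⁻¹ ^ (n + 3)), ‖lam - lam'‖ ≤ (p : ℝ)⁻¹ ^ (n + 3) := by
    intro lam hl lam' hl'
    rw [IsUltrametricDist.closedBall_eq_of_mem hl', mem_closedBall, dist_eq_norm] at hl
    exact hl
  have hdist2 : ∀ lam ∈ closedBall c' ((p : ℝ)⁻¹ ^ (n + 3)),
      ∀ lam' ∈ closedBall c' ((p : ℝ)⁻¹ ^ (n + 3)), ‖lam - lam'‖ ≤ (p : ℝ)⁻¹ ^ 2 :=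
    fun lam hl lam' hl' => (hdist lam hl lam' hl').trans (S.inv_pow_le_inv_pow (by omega))
  have hexit : ∀ lam ∈ closedBall c' ((p : ℝ)⁻¹ ^ (n + 3)),
      ∀ lam' ∈ closedBall c' ((p : ℝ)⁻¹ ^ (n + 3)),
      ‖(Qstar p a lam)^[n + 1] (W lam) - (Qstar p a lam')^[n + 1] (W lam')‖ ≤ (p : ℝ)⁻¹ ^ 2 := by
    intro lam hl lam' hl'
    rw [St.norm_exit_sub_eq S hh hn (hsub hl) (hsub hl'), ← hmul]
    exact mul_le_mul_of_nonneg_left (hdist lam hl lam' hl') (by positivity)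
  have hLand : ∀ lam ∈ closedBall c' ((p : ℝ)⁻¹ ^ (n + 3)),
      IsLanding p a ϑ lam (p * (n + 4)) ((Qstar p a lam)^[n + 1] (W lam)) := fun lam hl =>
    S.isLanding_of_close (hΛ lam hl) hL (hdist2 lam hl c' hself) (hexit lam hl c' hself)
  refine ⟨c', S.mem_of_mem_inv_mul hc', ⟨hΛ c' hself, ?_, ?_, ?_⟩, fun lam hl =>
    ⟨(St.near_one S hh hn (hsub hl)).2, hLand lam hl⟩⟩
  · exact S.polyApprox_iterate isBounded_closedBall ((St.polyApprox_exit S hh hn).mono hsub)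
      fun k hk lam hl =>
        ((hLand lam hl).norm_iterate_le (Nat.lt_succ_iff.1 hk)).trans S.ϑ_lt_one.le
  · intro lam hl lam' hl'
    rcases eq_or_ne lam lam' with rfl | hne
    · simp
    have hpos : 0 < ‖lam - lam'‖ := norm_pos_iff.2 (sub_ne_zero.2 hne)
    unfold nextPoint
    rw [Function.iterate_succ_apply' _ (p * (n + 4)), Function.iterate_succ_apply' _ (p * (n + 4))]
    have h1 := S.norm_iterate_sub_param_le (hΛ lam hl) (hLand lam' hl') (hdist2 lam hl lam' hl')
      (hexit lam hl lam' hl') le_rfl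
    have h2 := S.norm_iterate_sub_landing_le (hΛ lam hl) (hLand lam' hl')
      (hdist2 lam hl lam' hl') (hexit lam hl lam' hl') le_rfl
    have hx := (hLand lam hl).1
    have hy := (hLand lam' hl').1
    have hcon : ‖ϑ‖ ^ (p * (n + 4)) *
        ‖(Qstar p a lam)^[n + 1] (W lam) - (Qstar p a lam')^[n + 1] (W lam')‖ ≤
        ‖ϑ‖ * ‖lam - lam'‖ := by
      have hϑp : ‖ϑ‖ ^ p = (p : ℝ)⁻¹ := eq_inv_of_mul_eq_one_right S.norm_ϑ_pow
      rw [St.norm_exit_sub_eq S hh hn (hsub hl) (hsub hl'), pow_mul, hϑp, ← mul_assoc]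
      refine mul_le_mul_of_nonneg_right ?_ hpos.le
      rw [show n + 4 = (n + 1) + 3 by ring, pow_add _ (n + 1), mul_right_comm,
        mul_comm ((p : ℝ)⁻¹ ^ (n + 1)), S.pow_mul_inv_pow, one_mul]
      exact (pow_le_of_le_one hq.le S.inv_lt_one.le three_ne_zero).trans S.inv_le_ϑ
    rw [max_eq_right hcon] at h1
    set x := (Qstar p a lam)^[p * (n + 4)] ((Qstar p a lam)^[n + 1] (W lam))
    set y := (Qstar p a lam')^[p * (n + 4)] ((Qstar p a lam')^[n + 1] (W lam'))
    have h3 : ‖Qstar p a lam x - Qstar p a lam y‖ ≤ 1 * ‖x - y‖ :=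
      S.norm_Qstar_sub_le (hΛ lam hl) hx.le hy.le le_rfl h2 S.norm_ϑ_pow.le S.ϑ_lt_one.le
    have h4 : ‖Qstar p a lam y - Qstar p a lam' y‖ = ‖lam - lam'‖ := by
      rw [S.norm_Qstar_sub_param, hy, S.norm_ϑ_pow, norm_one_sub_eq (by rw [hy]; exact S.ϑ_lt_one)]
      ring
    rw [← sub_add_sub_cancel _ (Qstar p a lam y), add_comm, norm_add_eq_left_of_lt, h4]
    rw [h4]
    rw [one_mul] at h3
    exact (h3.trans h1).trans_lt (mul_lt_of_lt_one_left hpos S.ϑ_lt_one)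
  · exact hland.trans_lt (S.inv_pow_lt_inv_pow (by omega))

end Stage

end PerturbationData

namespace PerturbationData

variable {K : Type*} [NontriviallyNormedField K] [IsUltrametricDist K] [CompleteSpace K]
  [IsAlgClosed K] {p : ℕ} {a : ℕ → K} {rhat C : ℝ} {ϖ ϑ : K} {h : K → K}

theorem exists_stage (S : PerturbationData p a rhat C ϖ ϑ) (hh : IsFixedPointNearOne p a h)
    {c : K} (hc : ‖c - 1‖ < 1) (n : ℕ) :
    ∃ x : K, Stage p h n c fun lam => Qstar p a lam x := by
  have hp := S.p_pos
  have hq := S.inv_p_pos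
  obtain ⟨t, ht⟩ := IsAlgClosed.exists_pow_nat_eq ϑ two_pos
  have ht2 : ‖t‖ ^ 2 = ‖ϑ‖ := by rw [← norm_pow, ht]
  have ht1 : ‖t‖ < 1 := by
    refine lt_of_pow_lt_pow_left₀ 2 zero_le_one ?_
    rw [ht2, one_pow]
    exact S.ϑ_lt_one
  have hϖt : ‖ϖ‖ < ‖t‖ := by
    refine S.ϖ_lt_ϑ.trans_le ?_
    rw [← ht2]
    exact pow_le_of_le_one (norm_nonneg _) ht1.le two_ne_zero
  have hpt : 1 < p * ‖t‖ ^ p := by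
    refine lt_of_pow_lt_pow_left₀ 2 (by positivity) ?_
    rw [one_pow, mul_pow, ← pow_mul, mul_comm p 2, pow_mul, ht2, sq, mul_assoc, S.norm_ϑ_pow,
      mul_one]
    linarith [S.two_le]
  have hh1 : ‖h c‖ = 1 := norm_eq_one_of_norm_sub_one_lt (S.norm_fixed_sub_one_lt hh hc)
  have hF : PolyApprox (closedBall 0 ‖t‖) fun z => Qstar p a c z - h c :=
    (S.polyApprox_Qstar isBounded_closedBall (PolyApprox.const _ c) (PolyApprox.id _)
      fun z hz => (mem_closedBall_zero_iff.1 hz).trans ht1.le).sub isBounded_closedBall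
      (PolyApprox.const _ _)
  have h0 : ‖Qstar p a c 0 - h c‖ = 1 := by
    rw [norm_sub_rev, sub_eq_add_neg, norm_add_eq_left_of_lt, hh1]
    rw [hh1, norm_neg]
    exact (S.norm_Qstar_le_ϖ hc (by simp)).trans_lt S.ϖ_lt_one
  have h1 : 1 < ‖Qstar p a c t - h c‖ := by
    have h2 := S.norm_Qstar_eq hc hϖt ht1
    rw [sub_eq_add_neg, norm_add_eq_left_of_lt, h2]
    · exact hpt
    · rwa [h2, norm_neg, hh1]
  obtain ⟨x, hx, hland⟩ := hF.exists_norm_le_of_norm_ne (x := 0) (y := t)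
    (mem_closedBall_self (norm_nonneg _)) (mem_closedBall_zero_iff.2 le_rfl)
    (by rw [h0]; exact h1.ne) (pow_pos hq (n + 2))
  have hx1 : ‖x‖ < 1 := (mem_closedBall_zero_iff.1 hx).trans_lt ht1
  have hgx : ‖Qstar p a c x‖ = 1 := by
    rw [← hh1]
    refine norm_eq_of_norm_sub_lt_left ?_
    rw [hh1]
    exact hland.trans_lt (S.inv_pow_lt_one (by omega))
  have hϖx : ‖ϖ‖ < ‖x‖ := by
    by_contra! hle
    have := S.norm_Qstar_le_ϖ hc hle
    rw [hgx] at this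
    exact this.not_gt S.ϖ_lt_one
  have hpx : p * ‖x‖ ^ p = 1 := by rw [← S.norm_Qstar_eq hc hϖx hx1, hgx]
  refine ⟨x, hc, ?_, fun lam _ lam' _ => ?_, ?_⟩
  · exact S.polyApprox_Qstar isBounded_closedBall (PolyApprox.id _) (PolyApprox.const _ x)
      fun _ _ => hx1.le
  · rw [S.norm_Qstar_sub_param, hpx, norm_one_sub_eq hx1]
    ring
  · exact hland.trans_lt (S.inv_pow_lt_inv_pow (by omega))

/-- The marked points of all stages of the construction. -/
noncomputable def stagePoint (p : ℕ) (a : ℕ → K) (n : ℕ) (W : K → K) : ℕ → K → K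
  | 0 => W
  | i + 1 => nextPoint p a (n + 3 * i) (stagePoint p a n W i)

/-- A parameter near `lam₀` having an orbit which alternates between longer and longer visits near
`0` and near `1`. -/
theorem exists_itinerary (S : PerturbationData p a rhat C ϖ ϑ) (hh : IsFixedPointNearOne p a h)
    {lam₀ : K} (hl₀ : ‖lam₀ - 1‖ < 1) {n : ℕ} (hn : n ≠ 0) :
    ∃ lam ∈ closedBall lam₀ ((p : ℝ)⁻¹ ^ n), ∃ v : ℕ → K, ∀ i : ℕ,
      IsLanding p a ϑ lam (p * (n + 3 * i + 4)) (v i) ∧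
      (∀ k < n + 3 * i + 4,
        ‖(Qstar p a lam)^[k] ((Qstar p a lam)^[p * (n + 3 * i + 4) + 1] (v i)) - 1‖ < 1) ∧
      (Qstar p a lam)^[n + 3 * i + 4] ((Qstar p a lam)^[p * (n + 3 * i + 4) + 1] (v i)) =
        v (i + 1) := by
  have hq := S.inv_p_pos
  obtain ⟨x, hx⟩ := S.exists_stage hh hl₀ n
  set W := stagePoint p a n fun lam => Qstar p a lam x with hW
  let T : ℕ → Type _ := fun i => {c : K // Stage p h (n + 3 * i) c (W i)}
  have hnext : ∀ (i : ℕ) (c : T i), ∃ c' : T (i + 1),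
      c'.1 ∈ closedBall c.1 ((p : ℝ)⁻¹ ^ (n + 3 * i)) ∧
      ∀ lam ∈ closedBall c'.1 ((p : ℝ)⁻¹ ^ (n + 3 * (i + 1))),
        (∀ k < n + 3 * i + 1, ‖(Qstar p a lam)^[k] (W i lam) - 1‖ < 1) ∧
        IsLanding p a ϑ lam (p * (n + 3 * i + 4)) ((Qstar p a lam)^[n + 3 * i + 1] (W i lam)) := by
    intro i c
    obtain ⟨c', hc', hSt, hit⟩ := c.2.exists_next S hh (by omega)
    exact ⟨⟨c', hSt⟩, hc', hit⟩
  choose f hf hit using hnext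
  let c : ∀ i, T i := fun i => Nat.rec ⟨lam₀, hx⟩ (fun i ci => f i ci) i
  have hc : ∀ i, c (i + 1) = f i (c i) := fun i => rfl
  let B : ℕ → Set K := fun i => closedBall (c i).1 ((p : ℝ)⁻¹ ^ (n + 3 * i))
  have hmem : ∀ i, (c i).1 ∈ B i := fun i => mem_closedBall_self (by positivity)
  have hB : Antitone B := antitone_nat_of_succ_le fun i =>
    closedBall_subset_closedBall_of_mem (by rw [hc]; exact hf i _)
      (S.inv_pow_le_inv_pow (by omega))
  obtain ⟨lam, hlam⟩ : (⋂ i, B i).Nonempty := by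
    refine Metric.nonempty_iInter_of_nonempty_biInter (fun i => isClosed_closedBall)
      (fun i => isBounded_closedBall)
      (fun N => ⟨(c N).1, Set.mem_iInter₂.2 fun i hi => hB hi (hmem N)⟩) ?_
    have htend : Tendsto (fun i : ℕ => 2 * (p : ℝ)⁻¹ ^ (n + 3 * i)) atTop (nhds (2 * 0)) :=
      ((tendsto_pow_atTop_nhds_zero_of_lt_one hq.le S.inv_lt_one).comp
        (tendsto_atTop_mono (fun i => by omega : ∀ i : ℕ, i ≤ n + 3 * i) tendsto_id)).const_mul 2
    rw [mul_zero] at htend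
    exact squeeze_zero (fun _ => diam_nonneg) (fun i => diam_closedBall (by positivity)) htend
  have hlam' : ∀ i, lam ∈ B i := fun i => Set.mem_iInter.1 hlam i
  refine ⟨lam, hlam' 0, fun i => (Qstar p a lam)^[n + 3 * i + 1] (W i lam), fun i =>
    ⟨?_, ?_, rfl⟩⟩
  · refine (hit i (c i) lam ?_).2
    rw [← hc]
    exact hlam' (i + 1)
  · refine (hit (i + 1) (c (i + 1)) lam ?_).1
    rw [← hc]
    exact hlam' (i + 2)

end PerturbationData

namespace PerturbationData

variable {K : Type*} [NontriviallyNormedField K] {p : ℕ} {a : ℕ → K} {rhat C : ℝ} {ϖ ϑ : K}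
  {h : K → K}

theorem differentiableAt_Qser [CompleteSpace K] (S : PerturbationData p a rhat C ϖ ϑ) {z : K}
    (hz : ‖z‖ ≤ 1) : DifferentiableAt K (Qser a) z := by
  have hr0 : 0 ≤ rhat := (zero_lt_one.trans S.one_lt_rhat).le
  set P := FormalMultilinearSeries.ofScalars K a with hP
  have hrad : (Real.toNNReal rhat : ENNReal) ≤ P.radius := by
    refine P.le_radius_of_bound C fun i => ?_
    rw [Real.coe_toNNReal _ hr0, hP, FormalMultilinearSeries.ofScalars_norm]
    exact S.coeff_le i
  have hsum : P.sum = Qser a := by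
    funext x
    exact FormalMultilinearSeries.ofScalars_sum_eq a x
  have h1 : (1 : ENNReal) < Real.toNNReal rhat := by
    exact_mod_cast Real.one_lt_toNNReal.2 S.one_lt_rhat
  have hpos : 0 < P.radius := zero_lt_one.trans (h1.trans_le hrad)
  have hball := P.hasFPowerSeriesOnBall hpos
  rw [hsum] at hball
  refine (hball.analyticAt_of_mem ?_).differentiableAt
  rw [Metric.mem_eball, edist_zero_right]
  refine lt_of_le_of_lt ?_ (h1.trans_le hrad)
  rw [← ofReal_norm]
  exact ENNReal.ofReal_le_one.2 hz

theorem differentiableAt_Qstar [CompleteSpace K] (S : PerturbationData p a rhat C ϖ ϑ) (lam : K)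
    {z : K} (hz : ‖z‖ ≤ 1) : DifferentiableAt K (Qstar p a lam) z := by
  have h1 : DifferentiableAt K (Pfam p lam) z := by
    unfold Pfam
    fun_prop
  exact h1.add (S.differentiableAt_Qser hz)

/-- Starting times of the successive excursions. -/
def startTime (p : ℕ) (N : ℕ → ℕ) : ℕ → ℕ
  | 0 => 0
  | i + 1 => startTime p N i + (p * N i + 1) + N i

theorem le_startTime (p : ℕ) (N : ℕ → ℕ) (i : ℕ) : i ≤ startTime p N i := by
  induction i with
  | zero => simp
  | succ i ih =>
    rw [startTime]
    omega

theorem exists_startTime_add (p : ℕ) (N : ℕ → ℕ) (t : ℕ) :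
    ∃ i k, k < (p * N i + 1) + N i ∧ t = startTime p N i + k := by
  induction t with
  | zero => exact ⟨0, 0, by omega, rfl⟩
  | succ t ih =>
    obtain ⟨i, k, hk, rfl⟩ := ih
    rcases Nat.lt_or_ge (k + 1) ((p * N i + 1) + N i) with h | h
    · exact ⟨i, k + 1, h, rfl⟩
    · refine ⟨i + 1, 0, by omega, ?_⟩
      rw [startTime]
      omega

/-- The orbit of `y` alternates between visits of length `p * N i + 1` near `0` and of length `N i`
near `1`. -/
structure Itinerary (g : K → K) (p : ℕ) (θ : ℝ) (N : ℕ → ℕ) (y : K) : Prop where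
  near_zero : ∀ i, ∀ k < p * N i + 1, ‖g^[startTime p N i + k] y‖ ≤ θ
  near_one : ∀ i, ∀ k < N i, ‖g^[startTime p N i + (p * N i + 1) + k] y - 1‖ < 1

variable [IsUltrametricDist K] [CompleteSpace K]

theorem norm_deriv_Qstar (S : PerturbationData p a rhat C ϖ ϑ) {lam : K} (hl : ‖lam - 1‖ < 1)
    {z : K} (hz : ‖z - 1‖ < 1) : ‖deriv (Qstar p a lam) z‖ = p := by
  have hd := (S.differentiableAt_Qstar lam
    (norm_eq_one_of_norm_sub_one_lt hz).le).hasDerivAt.tendsto_slope.norm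
  refine tendsto_nhds_unique hd (tendsto_const_nhds.congr' ?_)
  have hnear : ∀ᶠ w in nhdsWithin z {z}ᶜ, ‖w - 1‖ < 1 :=
    nhdsWithin_le_nhds ((by fun_prop : Continuous fun w : K => ‖w - 1‖).continuousAt.eventually_lt
      continuousAt_const hz)
  filter_upwards [hnear, self_mem_nhdsWithin] with w hw hne
  have hne' : ‖w - z‖ ≠ 0 := norm_ne_zero_iff.2 (sub_ne_zero.2 hne)
  rw [slope_def_field, norm_div, S.norm_Qstar_sub_eq hl hw hz, mul_div_cancel_right₀ _ hne']

theorem norm_deriv_iterate_fixed (S : PerturbationData p a rhat C ϖ ϑ)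
    (hh : IsFixedPointNearOne p a h) {lam : K} (hl : ‖lam - 1‖ < 1) (k : ℕ) :
    1 ≤ ‖deriv (Qstar p a lam)^[k] (h lam)‖ := by
  have h1 := S.norm_fixed_sub_one_lt hh hl
  have hd := (S.differentiableAt_Qstar lam (norm_eq_one_of_norm_sub_one_lt h1).le).hasDerivAt
  rw [(hd.iterate (h lam) (hh lam hl).2 k).deriv, norm_pow, S.norm_deriv_Qstar hl h1]
  exact one_le_pow₀ (by linarith [S.two_le])

/-- The orbit of `y` spends the `p * N + 1` steps near `0` and then `N` steps near `1`. -/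
theorem excursion_of_close (S : PerturbationData p a rhat C ϖ ϑ) {lam : K} (hl : ‖lam - 1‖ < 1)
    {N : ℕ} {v y : K} (H : IsLanding p a ϑ lam (p * N) v)
    (hone : ∀ k < N, ‖(Qstar p a lam)^[k] ((Qstar p a lam)^[p * N + 1] v) - 1‖ < 1)
    (hy : ‖y - v‖ ≤ (p : ℝ)⁻¹ ^ 2) :
    IsLanding p a ϑ lam (p * N) y ∧
    (∀ k < N, ‖(Qstar p a lam)^[k] ((Qstar p a lam)^[p * N + 1] y) - 1‖ < 1) ∧
    ‖(Qstar p a lam)^[N] ((Qstar p a lam)^[p * N + 1] y) -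
      (Qstar p a lam)^[N] ((Qstar p a lam)^[p * N + 1] v)‖ ≤ (p : ℝ)⁻¹ ^ 2 := by
  have hp := S.p_pos
  have hq := S.inv_p_pos
  have hll : ‖lam - lam‖ ≤ (p : ℝ)⁻¹ ^ 2 := by
    rw [sub_self, norm_zero]
    positivity
  have H' := S.isLanding_of_close hl H hll hy
  have h1 := S.norm_iterate_sub_param_le hl H hll hy le_rfl
  have h2 := S.norm_iterate_sub_landing_le hl H hll hy le_rfl
  have hϑp : ‖ϑ‖ ^ p = (p : ℝ)⁻¹ := eq_inv_of_mul_eq_one_right S.norm_ϑ_pow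
  rw [sub_self, norm_zero, mul_zero, max_eq_left (by positivity), pow_mul, hϑp] at h1
  have h3 : ‖(Qstar p a lam)^[p * N + 1] y - (Qstar p a lam)^[p * N + 1] v‖ ≤
      (p : ℝ)⁻¹ ^ N * (p : ℝ)⁻¹ ^ 2 := by
    rw [Function.iterate_succ_apply', Function.iterate_succ_apply']
    refine (S.norm_Qstar_sub_le hl H'.1.le H.1.le le_rfl h2 S.norm_ϑ_pow.le
      S.ϑ_lt_one.le).trans ?_
    rw [one_mul]
    exact h1.trans (by gcongr)
  set y' := (Qstar p a lam)^[p * N + 1] y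
  set v' := (Qstar p a lam)^[p * N + 1] v
  have hbound : ∀ k ≤ N, (p : ℝ) ^ k * ((p : ℝ)⁻¹ ^ N * (p : ℝ)⁻¹ ^ 2) ≤ (p : ℝ)⁻¹ ^ 2 := by
    intro k hk
    rw [← mul_assoc]
    refine mul_le_of_le_one_left (by positivity) ?_
    rw [← S.pow_mul_inv_pow k]
    exact mul_le_mul_of_nonneg_left (S.inv_pow_le_inv_pow hk) (by positivity)
  have hclose : ∀ k ≤ N, (∀ j < k, ‖(Qstar p a lam)^[j] y' - 1‖ < 1) ∧
      ‖(Qstar p a lam)^[k] y' - (Qstar p a lam)^[k] v'‖ ≤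
        p ^ k * ((p : ℝ)⁻¹ ^ N * (p : ℝ)⁻¹ ^ 2) := by
    intro k hk
    induction k with
    | zero => simpa using h3
    | succ k ih =>
      obtain ⟨ih1, ih2⟩ := ih (by omega)
      have hk1 : ‖(Qstar p a lam)^[k] y' - 1‖ < 1 := by
        rw [← sub_add_sub_cancel _ ((Qstar p a lam)^[k] v')]
        exact norm_add_lt_of_lt_of_lt (ih2.trans_lt ((hbound k (by omega)).trans_lt
          (S.inv_pow_lt_one two_ne_zero))) (hone k hk)
      refine ⟨fun j hj => (Nat.lt_succ_iff_lt_or_eq.1 hj).elim (ih1 j) fun e => e ▸ hk1, ?_⟩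
      rw [Function.iterate_succ_apply', Function.iterate_succ_apply',
        S.norm_Qstar_sub_eq hl hk1 (hone k hk), pow_succ', mul_assoc]
      gcongr
  exact ⟨H', (hclose N le_rfl).1, (hclose N le_rfl).2.trans (hbound N le_rfl)⟩

theorem itinerary_of_mem (S : PerturbationData p a rhat C ϖ ϑ) {lam : K} (hl : ‖lam - 1‖ < 1)
    {N : ℕ → ℕ} {v : ℕ → K} (H : ∀ i, IsLanding p a ϑ lam (p * N i) (v i) ∧
      (∀ k < N i, ‖(Qstar p a lam)^[k] ((Qstar p a lam)^[p * N i + 1] (v i)) - 1‖ < 1) ∧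
      (Qstar p a lam)^[N i] ((Qstar p a lam)^[p * N i + 1] (v i)) = v (i + 1))
    {y : K} (hy : ‖y - v 0‖ ≤ (p : ℝ)⁻¹ ^ 2) :
    Itinerary (Qstar p a lam) p ‖ϑ‖ N y := by
  have hclose : ∀ i, ‖(Qstar p a lam)^[startTime p N i] y - v i‖ ≤ (p : ℝ)⁻¹ ^ 2 := by
    intro i
    induction i with
    | zero => exact hy
    | succ i ih =>
      have := (S.excursion_of_close hl (H i).1 (H i).2.1 ih).2.2
      rw [(H i).2.2, ← Function.iterate_add_apply, ← Function.iterate_add_apply] at this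
      rw [startTime]
      convert this using 4
      ring
  refine ⟨fun i k hk => ?_, fun i k hk => ?_⟩
  · have := (S.excursion_of_close hl (H i).1 (H i).2.1 (hclose i)).1.norm_iterate_le
      (Nat.lt_succ_iff.1 hk)
    rwa [← Function.iterate_add_apply, add_comm] at this
  · have := (S.excursion_of_close hl (H i).1 (H i).2.1 (hclose i)).2.1 k hk
    rw [← Function.iterate_add_apply, ← Function.iterate_add_apply] at this
    convert this using 4
    ring

end PerturbationData

section Conjugation

variable {K : Type*} [NontriviallyNormedField K]

theorem iterate_Qconj (p : ℕ) (a : ℕ → K) (h : K → K) (lam : K) (n : ℕ) (z : K) :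
    (Qconj p a h lam)^[n] z = (Qstar p a lam)^[n] (z + (h lam - 1)) - (h lam - 1) := by
  induction n with
  | zero => simp
  | succ n ih =>
    rw [Function.iterate_succ_apply', ih, Function.iterate_succ_apply', Qconj, add_sub_assoc,
      sub_add_cancel, sub_add]

theorem deriv_iterate_Qconj (p : ℕ) (a : ℕ → K) (h : K → K) (lam : K) (n : ℕ) (z : K) :
    deriv ((Qconj p a h lam)^[n]) z = deriv ((Qstar p a lam)^[n]) (z + (h lam - 1)) := by
  rw [funext (iterate_Qconj p a h lam n), deriv_sub_const,
    deriv_comp_add_const (f := (Qstar p a lam)^[n])]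

end Conjugation

namespace PerturbationData

variable {K : Type*} [NontriviallyNormedField K] [IsUltrametricDist K] {p : ℕ} {a : ℕ → K}
  {rhat C : ℝ} {ϖ ϑ : K} {h : K → K}

theorem Itinerary.norm_iterate_le_one {g : K → K} {θ : ℝ} (hθ : θ < 1) {N : ℕ → ℕ} {y : K}
    (I : Itinerary g p θ N y) (t : ℕ) : ‖g^[t] y‖ ≤ 1 := by
  obtain ⟨i, k, hk, rfl⟩ := exists_startTime_add p N t
  rcases Nat.lt_or_ge k (p * N i + 1) with hlt | hge
  · exact (I.near_zero i k hlt).trans hθ.le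
  · have := I.near_one i (k - (p * N i + 1)) (by omega)
    rw [add_assoc, Nat.add_sub_cancel' hge] at this
    exact (norm_eq_one_of_norm_sub_one_lt this).le

theorem Itinerary.iterate_ne {g : K → K} {θ : ℝ} (hθ : θ < 1) {N : ℕ → ℕ} (hN : ∀ i, i ≤ N i)
    {y y' : K} (I : Itinerary g p θ N y) (I' : Itinerary g p θ N y') {m n : ℕ} (hmn : m < n) :
    g^[m] y ≠ g^[n] y' := by
  obtain ⟨d, rfl⟩ := Nat.exists_eq_add_of_le hmn.le
  intro heq
  have hNi := hN (m + d)
  have hst := le_startTime p N (m + d)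
  set t := startTime p N (m + d) + (p * N (m + d) + 1) + (N (m + d) - d) with ht
  have h1 := norm_eq_one_of_norm_sub_one_lt (I.near_one (m + d) (N (m + d) - d) (by omega))
  rw [← ht] at h1
  have h0 := I'.near_zero (m + d + 1) 0 (by omega)
  have htd : startTime p N (m + d + 1) + 0 = t - m + (m + d) := by
    rw [startTime]
    omega
  have htm : t - m + m = t := by omega
  rw [htd, Function.iterate_add_apply, ← heq, ← Function.iterate_add_apply, htm, h1] at h0
  exact hθ.not_ge h0

variable [CompleteSpace K]

theorem Itinerary.norm_iterate_sub_fixed_lt (S : PerturbationData p a rhat C ϖ ϑ)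
    (hh : IsFixedPointNearOne p a h) {lam : K} (hl : ‖lam - 1‖ < 1) {θ : ℝ} {N : ℕ → ℕ}
    (hN : ∀ i, i < N i) {y : K} (I : Itinerary (Qstar p a lam) p θ N y) (i : ℕ) :
    ‖(Qstar p a lam)^[startTime p N i + (p * N i + 1)] y - h lam‖ < (p : ℝ)⁻¹ ^ i := by
  have hi := hN i
  set z := (Qstar p a lam)^[startTime p N i + (p * N i + 1)] y with hz
  have hnear : ∀ k < N i, ‖(Qstar p a lam)^[k] z - 1‖ < 1 := fun k hk => by
    have := I.near_one i k hk
    rwa [add_comm _ k, Function.iterate_add_apply] at this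
  have hfix : ∀ k, (Qstar p a lam)^[k] (h lam) = h lam := fun k =>
    Function.iterate_fixed (hh lam hl).2 k
  have h1 := S.norm_fixed_sub_one_lt hh hl
  have key := S.norm_iterate_sub_eq hl (k := i) (fun j hj => hnear j (by omega))
    (fun j _ => by rwa [hfix j])
  have hlt : ‖(Qstar p a lam)^[i] z - (Qstar p a lam)^[i] (h lam)‖ < 1 := by
    rw [hfix, ← sub_sub_sub_cancel_right _ _ (1 : K)]
    exact norm_sub_lt_of_lt_of_lt (hnear i hi) h1
  have hp := S.p_pos
  rw [key, ← S.pow_mul_inv_pow i] at hlt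
  exact lt_of_mul_lt_mul_left hlt (by positivity)

/-- A point whose orbit makes longer and longer visits near `1` is only attracted to cycles through
the repelling fixed point. -/
theorem Itinerary.not_tendsto (S : PerturbationData p a rhat C ϖ ϑ)
    (hh : IsFixedPointNearOne p a h) {lam : K} (hl : ‖lam - 1‖ < 1) {θ : ℝ} {N : ℕ → ℕ}
    (hN : ∀ i, i < N i) {y : K} (I : Itinerary (Qstar p a lam) p θ N y) {k : ℕ} (hk : 1 ≤ k)
    {w : K} (hw : (Qstar p a lam)^[k] w = w) (hd : ‖deriv ((Qstar p a lam)^[k]) w‖ < 1) :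
    ¬ Tendsto (fun n : ℕ => ⨅ j : Fin k, ‖(Qstar p a lam)^[n] y - (Qstar p a lam)^[(j : ℕ)] w‖)
      atTop (nhds 0) := by
  intro htend
  have : Nonempty (Fin k) := ⟨⟨0, hk⟩⟩
  obtain ⟨j₀, hj₀⟩ := Finite.exists_min fun j : Fin k => ‖(Qstar p a lam)^[(j : ℕ)] w - h lam‖
  have hcycle : (Qstar p a lam)^[(j₀ : ℕ)] w = h lam := by
    by_contra hne
    have hpos : 0 < ‖(Qstar p a lam)^[(j₀ : ℕ)] w - h lam‖ := norm_pos_iff.2 (sub_ne_zero.2 hne)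
    obtain ⟨M, hM⟩ := eventually_atTop.1 (htend.eventually_lt_const hpos)
    obtain ⟨q, hq⟩ := exists_pow_lt_of_lt_one hpos S.inv_lt_one
    set i := max M q
    have hi : M ≤ startTime p N i + (p * N i + 1) :=
      ((le_max_left M q).trans (le_startTime p N i)).trans (Nat.le_add_right _ _)
    obtain ⟨j, hj⟩ := exists_lt_of_ciInf_lt (hM _ hi)
    have h1 := (I.norm_iterate_sub_fixed_lt S hh hl hN i).trans
      ((S.inv_pow_le_inv_pow (le_max_right M q)).trans_lt hq)
    have h2 := norm_sub_lt_of_lt_of_lt h1 hj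
    rw [sub_sub_sub_cancel_left] at h2
    exact (hj₀ j).not_gt h2
  have hw' : w = h lam := by
    rw [← hw, ← Nat.sub_add_cancel j₀.2.le, Function.iterate_add_apply, hcycle]
    exact Function.iterate_fixed (hh lam hl).2 _
  rw [hw'] at hd
  exact hd.not_ge (S.norm_deriv_iterate_fixed hh hl k)

end PerturbationData

theorem exists_perturbationData {p : ℕ} (hp : p.Prime) {K : Type*} [NontriviallyNormedField K]
    [IsAlgClosed K] (hpnorm : ‖(p : K)‖ = (p : ℝ)⁻¹) {rhat C : ℝ} (hrhat : 1 < rhat) {a : ℕ → K}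
    (hC : C < (p : ℝ) ^ (-(1 : ℝ) / ((p : ℝ) - 1))) (ha : ∀ i : ℕ, ‖a i‖ * rhat ^ i ≤ C) :
    ∃ ϖ ϑ : K, PerturbationData p a rhat C ϖ ϑ := by
  have hp1 : 0 < p - 1 := Nat.sub_pos_of_lt hp.one_lt
  obtain ⟨ϖ, hϖ⟩ := IsAlgClosed.exists_pow_nat_eq (p : K) hp1
  obtain ⟨ϑ, hϑ⟩ := IsAlgClosed.exists_pow_nat_eq (p : K) hp.pos
  refine ⟨ϖ, ϑ, hp, hpnorm, hrhat, ha, hϖ, hϑ, ?_⟩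
  convert hC using 1
  have hcast : ((p - 1 : ℕ) : ℝ) = (p : ℝ) - 1 := by
    rw [Nat.cast_sub hp.one_le, Nat.cast_one]
  rw [← Real.pow_rpow_inv_natCast (norm_nonneg ϖ) hp1.ne', ← norm_pow, hϖ, hpnorm, hcast,
    ← Real.rpow_neg_one, ← Real.rpow_mul (Nat.cast_nonneg p), div_eq_mul_inv]

/-- For a dense set of parameters `λ ∈ Λ = {|λ − 1| < 1}`, the map `Q_λ` (the affine
conjugate of `Q*_λ = P_λ + Q` by `A_λ(z) = z + h(λ) − 1`) has a wandering disc contained in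
its filled Julia set `K(Q_λ, B)` which is not attracted to an attracting cycle.
Here `K` plays the role of `ℂ_p`. -/
theorem statement2 (p : ℕ) (hp : p.Prime)
    {K : Type*} [NontriviallyNormedField K] [IsAlgClosed K] [CompleteSpace K]
    [IsUltrametricDist K] [CharZero K]
    (hpnorm : ‖(p : K)‖ = (p : ℝ)⁻¹)
    (rhat : ℝ) (hrhat : 1 < rhat) (hrhatval : ∃ x : K, x ≠ 0 ∧ ‖x‖ = rhat)
    (a : ℕ → K)
    (hQnorm : ∃ C : ℝ, C < (p : ℝ) ^ (-(1:ℝ) / ((p : ℝ) - 1)) ∧ ∀ i : ℕ, ‖a i‖ * rhat ^ i ≤ C)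
    -- `h λ` is the unique fixed point of `Q*_λ` in `{z : |z − 1| ≤ |Q(1)|/p}`
    (h : K → K)
    (hfix : ∀ lam : K, ‖lam - 1‖ < 1 →
      ‖h lam - 1‖ ≤ ‖Qser a 1‖ / p ∧ Qstar p a lam (h lam) = h lam)
    (lam₀ : K) (hlam₀ : ‖lam₀ - 1‖ < 1) (ε : ℝ) (hε : 0 < ε) :
    ∃ lam : K, ‖lam - 1‖ < 1 ∧ ‖lam - lam₀‖ ≤ ε ∧
      ∃ (c : K) (r : ℝ), 0 < r ∧ closedBall c r ⊆ closedBall (0 : K) rhat ∧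
        -- (1) the disc stays in `B` under iteration (it lies in `K(Q_λ, B)`)
        (∀ z ∈ closedBall c r, ∀ n : ℕ, (Qconj p a h lam)^[n] z ∈ closedBall (0 : K) rhat) ∧
        -- (2) the iterated images of the disc are pairwise disjoint
        (∀ m n : ℕ, m ≠ n →
          ((Qconj p a h lam)^[m] '' closedBall c r) ∩
            ((Qconj p a h lam)^[n] '' closedBall c r) = ∅) ∧
        -- (3) the disc is not attracted to any attracting cycle in `B`
        (∀ k : ℕ, 1 ≤ k → ∀ z₀ ∈ closedBall (0 : K) rhat, (Qconj p a h lam)^[k] z₀ = z₀ →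
          ‖deriv ((Qconj p a h lam)^[k]) z₀‖ < 1 →
          ∀ x ∈ closedBall c r,
            ¬ Tendsto
              (fun n : ℕ =>
                ⨅ j : Fin k, ‖(Qconj p a h lam)^[n] x - (Qconj p a h lam)^[(j : ℕ)] z₀‖)
              atTop (nhds 0)) := by
  obtain ⟨C, hC, ha⟩ := hQnorm
  obtain ⟨ϖ, ϑ, S⟩ := exists_perturbationData hp hpnorm hrhat hC ha
  obtain ⟨n, hn⟩ := exists_pow_lt_of_lt_one hε S.inv_lt_one
  obtain ⟨lam, hlam, v, H⟩ := S.exists_itinerary hfix hlam₀ n.succ_ne_zero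
  have hl : ‖lam - 1‖ < 1 := S.norm_sub_one_lt_of_mem hlam₀ n.succ_ne_zero hlam
  set N : ℕ → ℕ := fun i => n.succ + 3 * i + 4 with hN
  have hNlt : ∀ i, i < N i := fun i => by
    simp only [hN]
    omega
  have hη : ‖h lam - 1‖ ≤ 1 := (S.norm_fixed_sub_one_lt hfix hl).le
  have I : ∀ z ∈ closedBall (v 0 - (h lam - 1)) ((p : ℝ)⁻¹ ^ 2),
      PerturbationData.Itinerary (Qstar p a lam) p ‖ϑ‖ N (z + (h lam - 1)) := fun z hz => by
    refine S.itinerary_of_mem hl H ?_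
    rwa [mem_closedBall, dist_eq_norm, sub_sub_eq_add_sub] at hz
  have hmem : ∀ z ∈ closedBall (v 0 - (h lam - 1)) ((p : ℝ)⁻¹ ^ 2), ∀ n : ℕ,
      (Qconj p a h lam)^[n] z ∈ closedBall (0 : K) rhat := fun z hz n => by
    rw [iterate_Qconj, mem_closedBall_zero_iff]
    exact (norm_sub_le_of_le_of_le ((I z hz).norm_iterate_le_one S.ϑ_lt_one n) hη).trans hrhat.le
  refine ⟨lam, hl, ?_, v 0 - (h lam - 1), (p : ℝ)⁻¹ ^ 2, pow_pos S.inv_p_pos 2,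
    fun z hz => hmem z hz 0, hmem, fun m n hmn => ?_, fun k hk z₀ _ hz₀ hd x hx => ?_⟩
  · rw [mem_closedBall, dist_eq_norm] at hlam
    exact hlam.trans ((S.inv_pow_le_inv_pow n.le_succ).trans hn.le)
  · refine Set.eq_empty_of_forall_notMem ?_
    rintro _ ⟨⟨y, hy, rfl⟩, y', hy', heq⟩
    rw [iterate_Qconj, iterate_Qconj, sub_left_inj] at heq
    rcases hmn.lt_or_gt with hlt | hlt
    · exact (I y hy).iterate_ne S.ϑ_lt_one (fun i => (hNlt i).le) (I y' hy') hlt heq.symm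
    · exact (I y' hy').iterate_ne S.ϑ_lt_one (fun i => (hNlt i).le) (I y hy) hlt heq
  · rw [deriv_iterate_Qconj] at hd
    rw [iterate_Qconj, sub_eq_iff_eq_add] at hz₀
    have := (I x hx).not_tendsto S hfix hl hNlt hk hz₀ hd
    simpa only [iterate_Qconj, sub_sub_sub_cancel_right] using this
end

section
/- Let f(z) = Σ_{i≥0} a_i z^i with a_i ∈ ℂ_p, and let r ∈ |ℂ_p^*| be such that |a_i|·r^i → 0 as i → ∞. Then f has a root α ∈ ℂ_p with |α| = r if and only if there exist integers 0 ≤ n < m such that |a_n|·r^n = |a_m|·r^m = sup_{i≥0} |a_i|·r^i. Moreover, if n and m are respectively the smallest and the largest integers attaining this supremum, then f has exactly m − n roots α with |α| = r, counted with multiplicity (the multiplicity of a root α being its order of vanishing as a zero of the analytic function f). -/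
open Filter Metric

/-- The order of vanishing of `f` at `z`: the least `k` such that the `k`-th derivative of
`f` at `z` is nonzero (the multiplicity of `z` as a zero of the analytic function `f`). -/
noncomputable def zeroOrder {K : Type*} [NontriviallyNormedField K] (f : K → K) (z : K) : ℕ :=
  sInf {k : ℕ | iteratedDeriv k f z ≠ 0}

section DominantRange

variable {K : Type*} [NormedField K]

/-- The norms of the coefficients `a i` attain their maximum `M > 0`, the first time at `n` and
the last time at `m`. -/
structure HasDominantRange (a : ℕ → K) (n m : ℕ) (M : ℝ) : Prop where
  pos : 0 < M
  le : ∀ i, ‖a i‖ ≤ M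
  left : ‖a n‖ = M
  right : ‖a m‖ = M
  lt_left : ∀ i < n, ‖a i‖ < M
  lt_right : ∀ i, m < i → ‖a i‖ < M

namespace HasDominantRange

variable {a : ℕ → K} {n m n' m' : ℕ} {M M' : ℝ}

theorem left_le_right (h : HasDominantRange a n m M) : n ≤ m := by
  by_contra! hlt
  exact (h.lt_right n hlt).ne h.left

theorem le_of_norm_eq (h : HasDominantRange a n m M) {i : ℕ} (hi : ‖a i‖ = M) :
    n ≤ i ∧ i ≤ m := by
  constructor <;> by_contra! hlt
  · exact (h.lt_left i hlt).ne hi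
  · exact (h.lt_right i hlt).ne hi

theorem unique (h : HasDominantRange a n m M) (h' : HasDominantRange a n' m' M') :
    n = n' ∧ m = m' ∧ M = M' := by
  obtain rfl : M = M' := le_antisymm (h.left ▸ h'.le n) (h'.left ▸ h.le n')
  exact ⟨le_antisymm (h.le_of_norm_eq h'.left).1 (h'.le_of_norm_eq h.left).1,
    le_antisymm (h'.le_of_norm_eq h.right).2 (h.le_of_norm_eq h'.right).2, rfl⟩

end HasDominantRange

theorem exists_hasDominantRange {a : ℕ → K} (ha : Tendsto a atTop (nhds 0)) {j : ℕ}
    (hj : a j ≠ 0) : ∃ n m M, HasDominantRange a n m M := by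
  have hfin : ∀ ε > 0, {i | ε ≤ ‖a i‖}.Finite := fun ε hε => by
    obtain ⟨N, hN⟩ := eventually_atTop.1 ((tendsto_zero_iff_norm_tendsto_zero.1 ha).eventually
      (gt_mem_nhds hε))
    exact (Set.finite_lt_nat N).subset fun i (hi : ε ≤ ‖a i‖) => by
      by_contra h
      exact absurd (hN i (not_lt.1 h)) hi.not_gt
  obtain ⟨k, hk, hmax⟩ := Set.exists_max_image {i | ‖a j‖ ≤ ‖a i‖} (fun i => ‖a i‖)
    (hfin _ (norm_pos_iff.2 hj)) ⟨j, le_refl ‖a j‖⟩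
  have hle : ∀ i, ‖a i‖ ≤ ‖a k‖ := fun i => by
    rcases le_total ‖a j‖ ‖a i‖ with h | h
    · exact hmax i h
    · exact h.trans hk
  have hpos : 0 < ‖a k‖ := (norm_pos_iff.2 hj).trans_le hk
  have hS := hfin _ hpos
  obtain ⟨n, hn, hnmin⟩ := Set.exists_min_image _ id hS ⟨k, le_refl ‖a k‖⟩
  obtain ⟨m, hm, hmmax⟩ := Set.exists_max_image _ id hS ⟨k, le_refl ‖a k‖⟩
  refine ⟨n, m, ‖a k‖, hpos, hle, (hle n).antisymm hn, (hle m).antisymm hm, fun i hi => ?_,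
    fun i hi => ?_⟩ <;> by_contra! h
  · exact absurd (hnmin i h) (not_le.2 hi)
  · exact absurd (hmmax i h) (not_le.2 hi)

/-- `f` is the coefficient sequence of `(X - β) G`, where `g` is the coefficient sequence of `G`. -/
def IsLinearMul (β : K) (g f : ℕ → K) : Prop :=
  f 0 = -(β * g 0) ∧ ∀ j, f (j + 1) = g j - β * g (j + 1)

namespace HasDominantRange

variable [IsUltrametricDist K] {β : K} {g f : ℕ → K} {n m : ℕ} {M : ℝ}

theorem norm_sub_le_max (x y : K) : ‖x - y‖ ≤ max ‖x‖ ‖y‖ := by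
  simpa [sub_eq_add_neg] using IsUltrametricDist.norm_add_le_max x (-y)

theorem norm_sub_lt_of_lt {x y : K} {C : ℝ} (hx : ‖x‖ < C) (hy : ‖y‖ < C) :
    ‖x - y‖ < C :=
  (norm_sub_le_max x y).trans_lt (max_lt hx hy)

theorem norm_sub_le_of_le {x y : K} {C : ℝ} (hx : ‖x‖ ≤ C) (hy : ‖y‖ ≤ C) :
    ‖x - y‖ ≤ C :=
  (norm_sub_le_max x y).trans (max_le hx hy)

theorem norm_sub_eq_left {x y : K} (h : ‖y‖ < ‖x‖) : ‖x - y‖ = ‖x‖ := by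
  rw [sub_eq_add_neg, IsUltrametricDist.norm_add_eq_max_of_norm_ne_norm
    (by rw [norm_neg]; exact h.ne'), norm_neg, max_eq_left h.le]

theorem norm_sub_eq_right {x y : K} (h : ‖x‖ < ‖y‖) : ‖x - y‖ = ‖y‖ := by
  rw [norm_sub_rev, norm_sub_eq_left h]

/-- Multiplication by `X - β` with `‖β‖ < 1`. -/
theorem linearMul_of_norm_lt (hg : HasDominantRange g n m M) (hf : IsLinearMul β g f)
    (hβ : ‖β‖ < 1) : HasDominantRange f (n + 1) (m + 1) M := by
  have hsmall : ∀ i, ‖β * g i‖ < M := fun i => by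
    rw [norm_mul]
    calc ‖β‖ * ‖g i‖ ≤ ‖β‖ * M := by gcongr; exact hg.le i
      _ < 1 * M := by gcongr; exact hg.pos
      _ = M := one_mul M
  have hlt : ∀ j, ‖g j‖ < M → ‖f (j + 1)‖ < M := fun j hj => by
    rw [hf.2]; exact norm_sub_lt_of_lt hj (hsmall _)
  have heq : ∀ j, ‖g j‖ = M → ‖f (j + 1)‖ = M := fun j hj => by
    rw [hf.2, norm_sub_eq_left (by rw [hj]; exact hsmall _), hj]
  have h0 : ‖f 0‖ < M := by rw [hf.1, norm_neg]; exact hsmall 0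
  refine ⟨hg.pos, ?_, heq n hg.left, heq m hg.right, ?_, ?_⟩
  · rintro (_ | j)
    · exact h0.le
    · rw [hf.2]; exact norm_sub_le_of_le (hg.le j) (hsmall _).le
  · rintro (_ | j) hj
    · exact h0
    · exact hlt j (hg.lt_left j (by omega))
  · rintro (_ | j) hj
    · exact h0
    · exact hlt j (hg.lt_right j (by omega))

/-- Multiplication by `X - β` with `‖β‖ = 1`. -/
theorem linearMul_of_norm_eq (hg : HasDominantRange g n m M) (hf : IsLinearMul β g f)
    (hβ : ‖β‖ = 1) : HasDominantRange f n (m + 1) M := by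
  have hnorm : ∀ i, ‖β * g i‖ = ‖g i‖ := fun i => by rw [norm_mul, hβ, one_mul]
  refine ⟨hg.pos, ?_, ?_, ?_, ?_, ?_⟩
  · rintro (_ | j)
    · rw [hf.1, norm_neg, hnorm]; exact hg.le 0
    · rw [hf.2]; exact norm_sub_le_of_le (hg.le j) ((hnorm _).trans_le (hg.le _))
  · rcases n with _ | j
    · rw [hf.1, norm_neg, hnorm, hg.left]
    · rw [hf.2, norm_sub_eq_right, hnorm, hg.left]
      rw [hnorm, hg.left]; exact hg.lt_left j (by omega)
  · rw [hf.2, norm_sub_eq_left, hg.right]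
    rw [hnorm, hg.right]; exact hg.lt_right _ (by omega)
  · rintro (_ | j) hj
    · rw [hf.1, norm_neg, hnorm]; exact hg.lt_left 0 hj
    · rw [hf.2]
      exact norm_sub_lt_of_lt (hg.lt_left j (by omega)) ((hnorm _).trans_lt (hg.lt_left _ hj))
  · rintro (_ | j) hj
    · omega
    · rw [hf.2]
      exact norm_sub_lt_of_lt (hg.lt_right j (by omega))
        ((hnorm _).trans_lt (hg.lt_right _ (by omega)))

/-- Multiplication by `X - β` with `‖β‖ > 1`. -/
theorem linearMul_of_lt_norm (hg : HasDominantRange g n m M) (hf : IsLinearMul β g f)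
    (hβ : 1 < ‖β‖) : HasDominantRange f n m (‖β‖ * M) := by
  have hsmall : ∀ i, ‖g i‖ < ‖β‖ * M := fun i => by nlinarith [hg.le i, hg.pos]
  have hle : ∀ i, ‖β * g i‖ ≤ ‖β‖ * M := fun i => by rw [norm_mul]; gcongr; exact hg.le i
  have hlt' : ∀ i, ‖g i‖ < M → ‖β * g i‖ < ‖β‖ * M := fun i hi => by rw [norm_mul]; gcongr
  have heq : ∀ i, ‖g i‖ = M → ‖f i‖ = ‖β‖ * M := by
    rintro (_ | j) hj
    · rw [hf.1, norm_neg, norm_mul, hj]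
    · have h : ‖β * g (j + 1)‖ = ‖β‖ * M := by rw [norm_mul, hj]
      rw [hf.2, norm_sub_eq_right (by rw [h]; exact hsmall j), h]
  have hlt : ∀ i, ‖g i‖ < M → ‖f i‖ < ‖β‖ * M := by
    rintro (_ | j) hj
    · rw [hf.1, norm_neg]; exact hlt' 0 hj
    · rw [hf.2]; exact norm_sub_lt_of_lt (hsmall j) (hlt' _ hj)
  refine ⟨mul_pos (one_pos.trans hβ) hg.pos, ?_, heq n hg.left, heq m hg.right,
    fun i hi => hlt i (hg.lt_left i hi), fun i hi => hlt i (hg.lt_right i hi)⟩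
  rintro (_ | j)
  · rw [hf.1, norm_neg]; exact hle 0
  · rw [hf.2]; exact norm_sub_le_of_le (hsmall j).le (hle _)

end HasDominantRange

end DominantRange

section PolynomialRoots

variable {K : Type*} [NormedField K]

open Polynomial

theorem Polynomial.isLinearMul_coeff (β : K) (P : K[X]) :
    IsLinearMul β P.coeff ((X - C β) * P).coeff :=
  ⟨by simp [sub_mul], fun j => by simp [sub_mul]⟩

theorem Multiset.exists_pow_card_le_prod {s : Multiset K} (hs : s ≠ 0) (x : K) :
    ∃ β ∈ s, ‖x - β‖ ^ s.card ≤ (s.map fun β => ‖x - β‖).prod := by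
  induction s using Multiset.induction_on with
  | empty => exact absurd rfl hs
  | cons γ s ih =>
    rcases eq_or_ne s 0 with rfl | hs0
    · exact ⟨γ, by simp, by simp⟩
    obtain ⟨β, hβ, hle⟩ := ih hs0
    simp only [Multiset.map_cons, Multiset.prod_cons, Multiset.card_cons, pow_succ']
    rcases le_total ‖x - β‖ ‖x - γ‖ with h | h
    · exact ⟨β, Multiset.mem_cons_of_mem hβ, by gcongr⟩
    · refine ⟨γ, Multiset.mem_cons_self _ _, ?_⟩
      gcongr
      exact (pow_le_pow_left₀ (norm_nonneg _) h _).trans hle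

variable [IsUltrametricDist K]

open Classical in
theorem exists_hasDominantRange_C_mul_prod {c : K} (hc : c ≠ 0) (s : Multiset K) :
    ∃ n M, HasDominantRange (C c * (s.map fun β => X - C β).prod).coeff n
        (n + (s.filter fun β => ‖β‖ = 1).card) M ∧
      ∀ x : K, ‖x‖ = 1 → ‖(C c * (s.map fun β => X - C β).prod).eval x‖ =
        M * ((s.filter fun β => ‖β‖ = 1).map fun β => ‖x - β‖).prod := by
  induction s using Multiset.induction_on with
  | empty =>
    refine ⟨0, ‖c‖, ⟨norm_pos_iff.2 hc, fun i => ?_, ?_, ?_, fun i hi => ?_, fun i hi => ?_⟩,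
      fun x hx => ?_⟩
    · rcases i with _ | i <;> simp [coeff_C]
    · simp
    · simp
    · omega
    · have : i ≠ 0 := by simp at hi; omega
      simpa [coeff_C, this] using hc
    · simp
  | cons β s ih =>
    obtain ⟨n, M, hP, hev⟩ := ih
    set P := C c * (s.map fun β => X - C β).prod with hPdef
    have hmul : C c * ((β ::ₘ s).map fun β => X - C β).prod = (X - C β) * P := by
      simp only [hPdef, Multiset.map_cons, Multiset.prod_cons]; ring
    have hlin := P.isLinearMul_coeff β
    rw [hmul]
    have hevmul : ∀ x, ‖((X - C β) * P).eval x‖ = ‖x - β‖ * ‖P.eval x‖ := fun x => by simp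
    rcases lt_trichotomy ‖β‖ 1 with h | h | h
    · refine ⟨n + 1, M, ?_, fun x hx => ?_⟩
      · rw [Multiset.filter_cons_of_neg (p := fun β : K => ‖β‖ = 1) _ h.ne, add_right_comm]
        exact hP.linearMul_of_norm_lt hlin h
      · rw [Multiset.filter_cons_of_neg (p := fun β : K => ‖β‖ = 1) _ h.ne, hevmul, hev x hx,
          HasDominantRange.norm_sub_eq_left (by rwa [hx]), hx, one_mul]
    · refine ⟨n, M, ?_, fun x hx => ?_⟩
      · rw [Multiset.filter_cons_of_pos (p := fun β : K => ‖β‖ = 1) _ h,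
          Multiset.card_cons, ← add_assoc]
        exact hP.linearMul_of_norm_eq hlin h
      · rw [Multiset.filter_cons_of_pos (p := fun β : K => ‖β‖ = 1) _ h,
          hevmul, hev x hx, Multiset.map_cons,
          Multiset.prod_cons, mul_left_comm]
    · refine ⟨n, ‖β‖ * M, ?_, fun x hx => ?_⟩
      · rw [Multiset.filter_cons_of_neg (p := fun β : K => ‖β‖ = 1) _ h.ne']
        exact hP.linearMul_of_lt_norm hlin h
      · rw [Multiset.filter_cons_of_neg (p := fun β : K => ‖β‖ = 1) _ h.ne', hevmul, hev x hx,
          HasDominantRange.norm_sub_eq_right (by rwa [hx]), mul_assoc]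

/-- A polynomial takes a small value at a point of the unit sphere only near one of its roots
on that sphere. -/
theorem HasDominantRange.exists_root_near [IsAlgClosed K] {P : K[X]} {n m : ℕ} {M : ℝ}
    (hP : HasDominantRange P.coeff n m M) (hnm : n < m) {x : K} (hx : ‖x‖ = 1) :
    ∃ β : K, ‖β‖ = 1 ∧ P.eval β = 0 ∧ M * ‖x - β‖ ^ (m - n) ≤ ‖P.eval x‖ := by
  classical
  have hP0 : P ≠ 0 := by
    rintro rfl
    exact hP.pos.ne (by simpa using hP.left)
  have hfac : P = C P.leadingCoeff * (P.roots.map fun β => X - C β).prod :=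
    (IsAlgClosed.splits P).eq_prod_roots
  obtain ⟨n', M', hdom, hev⟩ :=
    exists_hasDominantRange_C_mul_prod (leadingCoeff_ne_zero.2 hP0) P.roots
  rw [← hfac] at hdom hev
  obtain ⟨rfl, hm, rfl⟩ := hP.unique hdom
  have hcard : (P.roots.filter fun β => ‖β‖ = 1).card = m - n := by omega
  obtain ⟨β, hβ, hle⟩ := Multiset.exists_pow_card_le_prod
    (s := P.roots.filter fun β => ‖β‖ = 1) (by rw [← Multiset.card_pos]; omega) x
  rw [Multiset.mem_filter, mem_roots hP0] at hβ
  refine ⟨β, hβ.2, hβ.1, ?_⟩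
  rw [hev x hx, ← hcard]
  have := hP.pos
  gcongr

end PolynomialRoots

section Evaluation

variable {K : Type*} [NontriviallyNormedField K] [IsUltrametricDist K]

theorem norm_Qser_le {a : ℕ → K} {z : K} {C : ℝ} (ha : ∀ i, ‖a i‖ ≤ C) (hz : ‖z‖ ≤ 1) :
    ‖Qser a z‖ ≤ C := by
  refine IsUltrametricDist.norm_tsum_le_of_forall_le fun i => ?_
  rw [norm_mul, norm_pow]
  exact (mul_le_of_le_one_right (norm_nonneg _) (pow_le_one₀ (norm_nonneg _) hz)).trans (ha i)

theorem norm_pow_sub_pow_le_s4 {w z : K} (hw : ‖w‖ ≤ 1) (hz : ‖z‖ ≤ 1) (i : ℕ) :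
    ‖w ^ i - z ^ i‖ ≤ ‖w - z‖ := by
  induction i with
  | zero => simp
  | succ i ih =>
    have h : w ^ (i + 1) - z ^ (i + 1) = w * (w ^ i - z ^ i) + (w - z) * z ^ i := by ring
    rw [h]
    refine (IsUltrametricDist.norm_add_le_max _ _).trans (max_le ?_ ?_)
    · rw [norm_mul]
      exact (mul_le_of_le_one_left (norm_nonneg _) hw).trans ih
    · rw [norm_mul, norm_pow]
      exact mul_le_of_le_one_right (norm_nonneg _) (pow_le_one₀ (norm_nonneg _) hz)

theorem norm_pow_sub_pow_sub_le {w z : K} (hw : ‖w‖ ≤ 1) (hz : ‖z‖ ≤ 1) (i : ℕ) :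
    ‖w ^ (i + 1) - z ^ (i + 1) - (w - z) * ((i + 1) * z ^ i)‖ ≤ ‖w - z‖ ^ 2 := by
  induction i with
  | zero => simp
  | succ i ih =>
    have h : w ^ (i + 1 + 1) - z ^ (i + 1 + 1) - (w - z) * (((i + 1 : ℕ) + 1) * z ^ (i + 1)) =
        z * (w ^ (i + 1) - z ^ (i + 1) - (w - z) * ((i + 1) * z ^ i)) +
          (w - z) * (w ^ (i + 1) - z ^ (i + 1)) := by push_cast; ring
    rw [h]
    refine (IsUltrametricDist.norm_add_le_max _ _).trans (max_le ?_ ?_)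
    · rw [norm_mul]
      exact (mul_le_of_le_one_left (norm_nonneg _) hz).trans ih
    · rw [norm_mul, sq]
      gcongr
      exact norm_pow_sub_pow_le_s4 hw hz _

variable [CompleteSpace K]

theorem summable_mul_pow_of_tendsto_zero {a : ℕ → K} (ha : Tendsto a atTop (nhds 0)) {z : K}
    (hz : ‖z‖ ≤ 1) : Summable fun i => a i * z ^ i := by
  apply NonarchimedeanAddGroup.summable_of_tendsto_cofinite_zero
  rw [Nat.cofinite_eq_atTop]
  refine squeeze_zero_norm (fun i => ?_) (tendsto_zero_iff_norm_tendsto_zero.1 ha)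
  rw [norm_mul, norm_pow]
  exact mul_le_of_le_one_right (norm_nonneg _) (pow_le_one₀ (norm_nonneg _) hz)

/-- If a single term dominates, the series has no zero on the unit sphere. -/
theorem HasDominantRange.norm_Qser_eq {a : ℕ → K} {n : ℕ} {M : ℝ}
    (h : HasDominantRange a n n M) (ha : Tendsto a atTop (nhds 0)) {x : K} (hx : ‖x‖ = 1) :
    ‖Qser a x‖ = M := by
  set b := Function.update a n 0 with hb
  have hbn : b n = 0 := by simp [hb]
  have hba : ∀ i, i ≠ n → b i = a i := fun i hi => by simp [hb, hi]
  have hsplit : Qser a x = a n * x ^ n + Qser b x := by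
    rw [Qser, (summable_mul_pow_of_tendsto_zero ha hx.le).tsum_eq_add_tsum_ite n, Qser]
    congr 2 with i
    split_ifs with hi
    · simp [hi, hbn]
    · rw [hba i hi]
  have hb0 : Tendsto b atTop (nhds 0) := by
    refine ha.congr' ?_
    filter_upwards [eventually_gt_atTop n] with i hi
    rw [hba i hi.ne']
  have hrest : ‖Qser b x‖ < M := by
    by_cases hz : ∀ i, b i = 0
    · simpa [Qser, hz] using h.pos
    push Not at hz
    obtain ⟨j, hj⟩ := hz
    obtain ⟨k, m, M', hM'⟩ := exists_hasDominantRange hb0 hj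
    refine (norm_Qser_le hM'.le hx.le).trans_lt ?_
    have hk : k ≠ n := by
      rintro rfl
      exact hM'.pos.ne (by rw [← hM'.left, hbn, norm_zero])
    rw [← hM'.left, hba k hk]
    rcases hk.lt_or_gt with hk | hk
    · exact h.lt_left k hk
    · exact h.lt_right k hk
  have hterm : ‖a n * x ^ n‖ = M := by rw [norm_mul, norm_pow, hx, one_pow, mul_one, h.left]
  rw [hsplit, IsUltrametricDist.norm_add_eq_max_of_norm_ne_norm (by rw [hterm]; exact hrest.ne'),
    hterm, max_eq_left hrest.le]

/-- A root of the series on the unit sphere can be divided out. -/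
theorem exists_isLinearMul_of_root {a : ℕ → K} (ha : Tendsto a atTop (nhds 0)) {α : K}
    (hα : ‖α‖ ≤ 1) (h0 : Qser a α = 0) :
    ∃ g : ℕ → K, Tendsto g atTop (nhds 0) ∧ IsLinearMul α g a := by
  have htail : ∀ j, Tendsto (fun i => a (i + j)) atTop (nhds 0) := fun j =>
    (tendsto_add_atTop_iff_nat j).2 ha
  have hshift : ∀ j, Qser (fun i => a (i + j)) α =
      a j + α * Qser (fun i => a (i + (j + 1))) α := fun j => by
    rw [Qser, (summable_mul_pow_of_tendsto_zero (htail j) hα).tsum_eq_zero_add, Qser,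
      ← tsum_mul_left]
    congr 1
    · simp
    · refine tsum_congr fun i => ?_
      rw [add_right_comm, add_assoc]; ring
  refine ⟨fun j => Qser (fun i => a (i + (j + 1))) α, ?_, ?_, fun j => ?_⟩
  · rw [Metric.tendsto_atTop] at ha ⊢
    intro ε hε
    obtain ⟨N, hN⟩ := ha (ε / 2) (half_pos hε)
    refine ⟨N, fun j hj => ?_⟩
    rw [dist_zero_right]
    refine (norm_Qser_le (C := ε / 2) (fun i => ?_) hα).trans_lt (half_lt_self hε)
    simpa using (hN (i + (j + 1)) (by omega)).le
  · have h := hshift 0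
    simp only [add_zero, h0] at h
    exact eq_neg_of_add_eq_zero_left h.symm
  · exact eq_sub_of_add_eq (hshift (j + 1)).symm

theorem IsLinearMul.Qser_eq {α : K} {g a : ℕ → K} (h : IsLinearMul α g a)
    (hg : Tendsto g atTop (nhds 0)) (ha : Tendsto a atTop (nhds 0)) {z : K} (hz : ‖z‖ ≤ 1) :
    Qser a z = (z - α) * Qser g z := by
  have hsg := summable_mul_pow_of_tendsto_zero hg hz
  have hsg' : Summable fun i => g (i + 1) * z ^ (i + 1) :=
    (summable_nat_add_iff (f := fun i => g i * z ^ i) 1).2 hsg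
  have h1 : Qser g z = g 0 + ∑' i, g (i + 1) * z ^ (i + 1) := by
    rw [Qser, hsg.tsum_eq_zero_add]; simp
  have h2 : Qser a z = a 0 + ∑' i, a (i + 1) * z ^ (i + 1) := by
    rw [Qser, (summable_mul_pow_of_tendsto_zero ha hz).tsum_eq_zero_add]; simp
  have h3 : ∑' i, a (i + 1) * z ^ (i + 1) =
      z * Qser g z - α * ∑' i, g (i + 1) * z ^ (i + 1) := by
    rw [Qser, ← tsum_mul_left, ← tsum_mul_left,
      ← (hsg.mul_left z).tsum_sub (hsg'.mul_left α)]
    refine tsum_congr fun i => ?_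
    rw [h.2]; ring
  rw [h2, h3, h.1, sub_mul]
  conv_rhs => enter [2]; rw [h1]
  ring

/-- A power series dominated by several terms has a root on the unit sphere. -/
theorem HasDominantRange.exists_root [IsAlgClosed K] {a : ℕ → K} {n m : ℕ} {M : ℝ}
    (h : HasDominantRange a n m M) (ha : Tendsto a atTop (nhds 0)) (hnm : n < m) :
    ∃ α : K, ‖α‖ = 1 ∧ Qser a α = 0 := by
  classical
  set P : ℕ → Polynomial K := fun k =>
    ∑ i ∈ Finset.range (m + 1 + k), Polynomial.monomial i (a i) with hP
  have hcoeff : ∀ k i, (P k).coeff i = if i < m + 1 + k then a i else 0 := fun k i => by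
    simp [hP, Polynomial.coeff_monomial]
  have heval : ∀ k x, (P k).eval x = ∑ i ∈ Finset.range (m + 1 + k), a i * x ^ i := fun k x => by
    simp [hP, Polynomial.eval_finsetSum]
  have hdom : ∀ k, HasDominantRange (P k).coeff n m M := fun k => by
    have hin : ∀ i ≤ m, (P k).coeff i = a i := fun i hi => by rw [hcoeff, if_pos (by omega)]
    have hle : ∀ i, ‖(P k).coeff i‖ ≤ ‖a i‖ := fun i => by
      rw [hcoeff]; split_ifs <;> simp
    exact ⟨h.pos, fun i => (hle i).trans (h.le i), by rw [hin n hnm.le, h.left],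
      by rw [hin m le_rfl, h.right], fun i hi => (hle i).trans_lt (h.lt_left i hi),
      fun i hi => (hle i).trans_lt (h.lt_right i hi)⟩
  have hstep : ∀ k (x : {x : K // ‖x‖ = 1 ∧ (P k).eval x = 0}),
      ∃ y : {y : K // ‖y‖ = 1 ∧ (P (k + 1)).eval y = 0},
        M * ‖(x : K) - y‖ ^ (m - n) ≤ ‖a (m + 1 + k)‖ := by
    rintro k ⟨x, hx, hroot⟩
    obtain ⟨β, hβ, hβ0, hle⟩ := (hdom (k + 1)).exists_root_near hnm hx
    refine ⟨⟨β, hβ, hβ0⟩, hle.trans_eq ?_⟩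
    rw [heval] at hroot ⊢
    rw [← add_assoc, Finset.sum_range_succ, hroot, zero_add, norm_mul, norm_pow, hx, one_pow,
      mul_one]
  obtain ⟨x₀, hx₀, hx₀', -⟩ := (hdom 0).exists_root_near hnm (norm_one (α := K))
  choose next hnext using hstep
  set u : ∀ k, {x : K // ‖x‖ = 1 ∧ (P k).eval x = 0} :=
    fun k => Nat.rec ⟨x₀, hx₀, hx₀'⟩ next k with hu
  have hdist : ∀ k, M * ‖(u k : K) - u (k + 1)‖ ^ (m - n) ≤ ‖a (m + 1 + k)‖ :=
    fun k => hnext k (u k)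
  have hdiff : Tendsto (fun k => (u (k + 1) : K) - u k) atTop (nhds 0) := by
    rw [Metric.tendsto_atTop] at ha ⊢
    intro ε hε
    obtain ⟨N, hN⟩ := ha (M * ε ^ (m - n)) (mul_pos h.pos (pow_pos hε _))
    refine ⟨N, fun k hk => ?_⟩
    have h1 := (hdist k).trans_lt (by simpa using hN (m + 1 + k) (by omega))
    rw [dist_zero_right, norm_sub_rev]
    exact lt_of_pow_lt_pow_left₀ _ hε.le (lt_of_mul_lt_mul_left h1 h.pos.le)
  obtain ⟨α, hα⟩ := cauchySeq_tendsto_of_complete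
    (NonarchimedeanAddGroup.cauchySeq_of_tendsto_sub_nhds_zero
      (f := fun k => (u k : K)) hdiff)
  have hα1 : ‖α‖ = 1 := by
    refine tendsto_nhds_unique hα.norm ?_
    simp only [(u _).2.1]
    exact tendsto_const_nhds
  refine ⟨α, hα1, ?_⟩
  have hlim : Tendsto (fun k => (P k).eval α) atTop (nhds (Qser a α)) := by
    simp only [heval]
    have := (summable_mul_pow_of_tendsto_zero ha hα1.le).hasSum.tendsto_sum_nat
    refine this.comp (tendsto_atTop_mono (fun k => ?_) tendsto_id)
    simp
  refine tendsto_nhds_unique hlim (squeeze_zero_norm (a := fun k => M * ‖α - u k‖) (fun k => ?_) ?_)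
  · have hsub : (P k).eval α =
        ∑ i ∈ Finset.range (m + 1 + k), a i * (α ^ i - (u k : K) ^ i) := by
      have := (u k).2.2
      rw [heval] at this ⊢
      simp only [mul_sub, Finset.sum_sub_distrib, this, sub_zero]
    rw [hsub]
    refine IsUltrametricDist.norm_sum_le_of_forall_le_of_nonneg
      (mul_nonneg h.pos.le (norm_nonneg _)) fun i _ => ?_
    rw [norm_mul]
    exact mul_le_mul (h.le i) (norm_pow_sub_pow_le_s4 hα1.le (u k).2.1.le i) (norm_nonneg _) h.pos.le
  · have := (tendsto_const_nhds (x := α)).sub hα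
    simpa using this.norm.const_mul M

end Evaluation

section Multiplicity

open PowerSeries

variable {K : Type*} [NontriviallyNormedField K]

theorem isLinearMul_mk_iff {α : K} {g f : ℕ → K} :
    IsLinearMul α g f ↔ mk f = (X - C α) * mk g := by
  constructor
  · intro h
    ext (_ | j)
    · simp [sub_mul, h.1]
    · simp [sub_mul, coeff_succ_X_mul, h.2]
  · intro h
    refine ⟨?_, fun j => ?_⟩
    · simpa [sub_mul] using congrArg (coeff 0) h
    · simpa [sub_mul, coeff_succ_X_mul] using congrArg (coeff (j + 1)) h

theorem iterate_derivative_linear_mul (α : K) (G : PowerSeries K) (k : ℕ) :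
    (d⁄dX K)^[k + 1] ((X - C α) * G) =
      (X - C α) * (d⁄dX K)^[k + 1] G + C (k + 1 : K) * (d⁄dX K)^[k] G := by
  induction k with
  | zero => simp [Derivation.leibniz]
  | succ k ih =>
    rw [Function.iterate_succ_apply', ih]
    simp only [map_add, Derivation.leibniz, smul_eq_mul, map_sub, derivative_X, derivative_C,
      ← Function.iterate_succ_apply' (d⁄dX K)]
    push_cast
    simp only [map_add, map_one]
    ring

/-- `k` is the order of vanishing of the power series `F` at `z`, computed with formal
derivatives. -/
def HasVanishingOrder (F : PowerSeries K) (z : K) (k : ℕ) : Prop :=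
  Qser (fun i => coeff i ((d⁄dX K)^[k] F)) z ≠ 0 ∧
    ∀ j < k, Qser (fun i => coeff i ((d⁄dX K)^[j] F)) z = 0

variable [IsUltrametricDist K]

theorem tendsto_coeff_derivative {F : PowerSeries K}
    (hF : Tendsto (fun i => coeff i F) atTop (nhds 0)) :
    Tendsto (fun i => coeff i (d⁄dX K F)) atTop (nhds 0) := by
  have h := tendsto_zero_iff_norm_tendsto_zero.1 ((tendsto_add_atTop_iff_nat 1).2 hF)
  refine squeeze_zero_norm (fun i => ?_) h
  rw [coeff_derivative, norm_mul]
  refine mul_le_of_le_one_right (norm_nonneg _) ?_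
  exact_mod_cast IsUltrametricDist.norm_natCast_le_one K (i + 1)

theorem tendsto_coeff_iterate_derivative {F : PowerSeries K}
    (hF : Tendsto (fun i => coeff i F) atTop (nhds 0)) (k : ℕ) :
    Tendsto (fun i => coeff i ((d⁄dX K)^[k] F)) atTop (nhds 0) := by
  induction k with
  | zero => exact hF
  | succ k ih => rw [Function.iterate_succ_apply']; exact tendsto_coeff_derivative ih

theorem tendsto_coeff_linear_mul {G : PowerSeries K} {α : K}
    (hG : Tendsto (fun i => coeff i G) atTop (nhds 0)) :
    Tendsto (fun i => coeff i ((X - C α) * G)) atTop (nhds 0) := by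
  rw [← tendsto_add_atTop_iff_nat 1]
  simpa [sub_mul, coeff_succ_X_mul] using
    hG.sub (((tendsto_add_atTop_iff_nat 1).2 hG).const_mul α)

variable [CompleteSpace K]

theorem hasDerivAt_Qser {F : PowerSeries K} (hF : Tendsto (fun i => coeff i F) atTop (nhds 0))
    {z : K} (hz : ‖z‖ ≤ 1) :
    HasDerivAt (Qser fun i => coeff i F) (Qser (fun i => coeff i (d⁄dX K F)) z) z := by
  obtain ⟨C, hC⟩ := hF.norm.bddAbove_range
  have hC : ∀ i, ‖coeff i F‖ ≤ C := fun i => hC ⟨i, rfl⟩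
  have hC0 : 0 ≤ C := (norm_nonneg _).trans (hC 0)
  rw [hasDerivAt_iff_isLittleO]
  refine Asymptotics.IsBigO.trans_isLittleO (g := fun w => (w - z) ^ 2) ?_ ?_
  · refine Asymptotics.IsBigO.of_bound C ?_
    filter_upwards [Metric.closedBall_mem_nhds z one_pos] with w hw
    have hw1 : ‖w‖ ≤ 1 := by
      rw [mem_closedBall, dist_eq_norm] at hw
      simpa using (IsUltrametricDist.norm_add_le_max (w - z) z).trans (max_le hw hz)
    have hsub : Qser (fun i => coeff i F) w - Qser (fun i => coeff i F) z -
        (w - z) • Qser (fun i => coeff i (d⁄dX K F)) z = ∑' i, coeff (i + 1) F *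
          (w ^ (i + 1) - z ^ (i + 1) - (w - z) * ((i + 1) * z ^ i)) := by
      have hsw := summable_mul_pow_of_tendsto_zero hF hw1
      have hsz := summable_mul_pow_of_tendsto_zero hF hz
      have hsd := summable_mul_pow_of_tendsto_zero (tendsto_coeff_derivative hF) hz
      have hsw' := (summable_nat_add_iff (f := fun i => coeff i F * w ^ i) 1).2 hsw
      have hsz' := (summable_nat_add_iff (f := fun i => coeff i F * z ^ i) 1).2 hsz
      simp only [Qser, smul_eq_mul]
      rw [hsw.tsum_eq_zero_add, hsz.tsum_eq_zero_add, ← tsum_mul_left]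
      simp only [pow_zero, add_sub_add_left_eq_sub]
      rw [← hsw'.tsum_sub hsz', ← (hsw'.sub hsz').tsum_sub (hsd.mul_left _)]
      refine tsum_congr fun i => ?_
      rw [coeff_derivative]; ring
    rw [hsub, norm_pow]
    refine IsUltrametricDist.norm_tsum_le_of_forall_le fun i => ?_
    rw [norm_mul]
    exact mul_le_mul (hC _) (norm_pow_sub_pow_sub_le hw1 hz i) (norm_nonneg _) hC0
  · exact ((Asymptotics.isLittleO_pow_sub_sub z one_lt_two).congr_left
      fun w => (norm_pow (w - z) 2).symm).of_norm_left

theorem iteratedDeriv_Qser {F : PowerSeries K} (hF : Tendsto (fun i => coeff i F) atTop (nhds 0))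
    (k : ℕ) {z : K} (hz : ‖z‖ ≤ 1) :
    iteratedDeriv k (Qser fun i => coeff i F) z =
      Qser (fun i => coeff i ((d⁄dX K)^[k] F)) z := by
  induction k generalizing z with
  | zero => simp
  | succ k ih =>
    have hev : iteratedDeriv k (Qser fun i => coeff i F) =ᶠ[nhds z]
        Qser fun i => coeff i ((d⁄dX K)^[k] F) := by
      filter_upwards [Metric.closedBall_mem_nhds z one_pos] with w hw
      rw [mem_closedBall, dist_eq_norm] at hw
      exact ih (by simpa using (IsUltrametricDist.norm_add_le_max (w - z) z).trans (max_le hw hz))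
    rw [iteratedDeriv_succ, hev.deriv_eq, Function.iterate_succ_apply',
      (hasDerivAt_Qser (tendsto_coeff_iterate_derivative hF k) hz).deriv]

theorem HasVanishingOrder.zeroOrder_eq {F : PowerSeries K} {z : K} {k : ℕ}
    (h : HasVanishingOrder F z k) (hF : Tendsto (fun i => coeff i F) atTop (nhds 0))
    (hz : ‖z‖ ≤ 1) : zeroOrder (Qser fun i => coeff i F) z = k := by
  refine IsLeast.csInf_eq ⟨?_, fun j hj => ?_⟩
  · rw [Set.mem_ofPred_eq, iteratedDeriv_Qser hF k hz]
    exact h.1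
  · rw [Set.mem_ofPred_eq, iteratedDeriv_Qser hF j hz] at hj
    by_contra! hlt
    exact hj (h.2 j hlt)

section LinearFactor

variable {G : PowerSeries K} {α z : K}

theorem Qser_linear_mul (hG : Tendsto (fun i => coeff i G) atTop (nhds 0)) (hz : ‖z‖ ≤ 1) :
    Qser (fun i => coeff i ((X - C α) * G)) z = (z - α) * Qser (fun i => coeff i G) z :=
  IsLinearMul.Qser_eq ⟨by simp [sub_mul], fun j => by simp [sub_mul, coeff_succ_X_mul]⟩ hG
    (tendsto_coeff_linear_mul hG) hz

theorem Qser_iterate_derivative_linear_mul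
    (hG : Tendsto (fun i => coeff i G) atTop (nhds 0)) (hz : ‖z‖ ≤ 1) (k : ℕ) :
    Qser (fun i => coeff i ((d⁄dX K)^[k + 1] ((X - C α) * G))) z =
      (z - α) * Qser (fun i => coeff i ((d⁄dX K)^[k + 1] G)) z +
        (k + 1) * Qser (fun i => coeff i ((d⁄dX K)^[k] G)) z := by
  have h1 := tendsto_coeff_iterate_derivative hG (k + 1)
  have h0 := tendsto_coeff_iterate_derivative hG k
  rw [← Qser_linear_mul h1 hz, iterate_derivative_linear_mul]
  have hs := summable_mul_pow_of_tendsto_zero (tendsto_coeff_linear_mul (α := α) h1) hz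
  have hs' := (summable_mul_pow_of_tendsto_zero h0 hz).mul_left (k + 1 : K)
  simp only [Qser]
  rw [← tsum_mul_left, ← hs.tsum_add hs']
  refine tsum_congr fun i => ?_
  rw [map_add, coeff_C_mul]; ring

theorem HasVanishingOrder.linear_mul_self [CharZero K] {k : ℕ} (h : HasVanishingOrder G α k)
    (hG : Tendsto (fun i => coeff i G) atTop (nhds 0)) (hα : ‖α‖ ≤ 1) :
    HasVanishingOrder ((X - C α) * G) α (k + 1) := by
  refine ⟨?_, ?_⟩
  · rw [Qser_iterate_derivative_linear_mul hG hα, sub_self, zero_mul, zero_add]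
    exact mul_ne_zero (by exact_mod_cast k.succ_ne_zero) h.1
  · rintro (_ | j) hj
    · rw [Function.iterate_zero_apply, Qser_linear_mul hG hα, sub_self, zero_mul]
    · rw [Qser_iterate_derivative_linear_mul hG hα, sub_self, zero_mul, zero_add,
        h.2 j (by omega), mul_zero]

theorem HasVanishingOrder.linear_mul_of_ne {k : ℕ} (h : HasVanishingOrder G z k)
    (hG : Tendsto (fun i => coeff i G) atTop (nhds 0)) (hz : ‖z‖ ≤ 1) (hne : z ≠ α) :
    HasVanishingOrder ((X - C α) * G) z k := by
  have hne' := sub_ne_zero.2 hne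
  have hval : ∀ j, j ≤ k → Qser (fun i => coeff i ((d⁄dX K)^[j] ((X - C α) * G))) z =
      (z - α) * Qser (fun i => coeff i ((d⁄dX K)^[j] G)) z := by
    rintro (_ | j) hj
    · exact Qser_linear_mul hG hz
    · rw [Qser_iterate_derivative_linear_mul hG hz, h.2 j (by omega), mul_zero, add_zero]
  refine ⟨?_, fun j hj => ?_⟩
  · rw [hval k le_rfl]
    exact mul_ne_zero hne' h.1
  · rw [hval j hj.le, h.2 j hj, mul_zero]

end LinearFactor

open Classical in
theorem exists_multiset_roots [IsAlgClosed K] [CharZero K] (d : ℕ) {a : ℕ → K}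
    (ha : Tendsto a atTop (nhds 0)) {n : ℕ} {M : ℝ} (h : HasDominantRange a n (n + d) M) :
    ∃ S : Multiset K, S.card = d ∧ (∀ β ∈ S, ‖β‖ = 1) ∧
      ∀ β : K, ‖β‖ = 1 → HasVanishingOrder (mk a) β (S.count β) := by
  induction d generalizing a n M with
  | zero =>
    refine ⟨0, rfl, by simp, fun β hβ => ⟨?_, by simp⟩⟩
    simpa [← norm_pos_iff, h.norm_Qser_eq ha hβ] using h.pos
  | succ d ih =>
    obtain ⟨α, hα, h0⟩ := h.exists_root ha (by omega)
    obtain ⟨g, hg, hlin⟩ := exists_isLinearMul_of_root ha hα.le h0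
    obtain ⟨j, hj⟩ : ∃ j, g j ≠ 0 := by
      by_contra! hz
      have hn : a n = 0 := by
        rcases n with _ | j
        · simp [hlin.1, hz]
        · simp [hlin.2, hz]
      exact h.pos.ne (by rw [← h.left, hn, norm_zero])
    obtain ⟨n', m', M', hdom⟩ := exists_hasDominantRange hg hj
    obtain ⟨rfl, hm, rfl⟩ := h.unique (hdom.linearMul_of_norm_eq hlin hα)
    obtain rfl : m' = n + d := by omega
    obtain ⟨S, hcard, hS, hcount⟩ := ih hg hdom
    have hgc : Tendsto (fun i => coeff i (mk g)) atTop (nhds 0) := by simpa using hg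
    refine ⟨α ::ₘ S, by simp [hcard], by simpa [hα] using hS, fun β hβ => ?_⟩
    rw [isLinearMul_mk_iff.1 hlin]
    rcases eq_or_ne β α with rfl | hne
    · rw [Multiset.count_cons_self]
      exact (hcount β hβ).linear_mul_self hgc hβ.le
    · rw [Multiset.count_cons_of_ne hne]
      exact (hcount β hβ).linear_mul_of_ne hgc hβ.le hne

open Classical in
/-- The number of zeros on the unit sphere, with multiplicity, is the length of the range of
dominant coefficients. -/
theorem exists_finset_roots_unit_sphere [IsAlgClosed K] [CharZero K] {a : ℕ → K}
    (ha : Tendsto a atTop (nhds 0)) {n m : ℕ} {M : ℝ} (h : HasDominantRange a n m M) :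
    ∃ T : Finset K, (∀ α, α ∈ T ↔ ‖α‖ = 1 ∧ Qser a α = 0) ∧
      ∑ α ∈ T, zeroOrder (Qser a) α = m - n := by
  obtain ⟨d, rfl⟩ := Nat.exists_eq_add_of_le h.left_le_right
  obtain ⟨S, hcard, hS, hord⟩ := exists_multiset_roots d ha h
  have hac : Tendsto (fun i => coeff i (mk a)) atTop (nhds 0) := by simpa using ha
  refine ⟨S.toFinset, fun α => ?_, ?_⟩
  · rw [Multiset.mem_toFinset]
    refine ⟨fun hα => ⟨hS α hα, ?_⟩, fun ⟨hα, h0⟩ => ?_⟩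
    · simpa using (hord α (hS α hα)).2 0 (Multiset.count_pos.2 hα)
    · by_contra hmem
      have := (hord α hα).1
      rw [Multiset.count_eq_zero_of_notMem hmem] at this
      exact this (by simpa using h0)
  · rw [Nat.add_sub_cancel_left, ← hcard, ← Multiset.toFinset_sum_count_eq]
    refine Finset.sum_congr rfl fun α hα => ?_
    have hα1 := hS α (Multiset.mem_toFinset.1 hα)
    simpa using (hord α hα1).zeroOrder_eq hac hα1.le

end Multiplicity

section Rescaling

variable {K : Type*} [NontriviallyNormedField K]

theorem Qser_eq_rescale (a : ℕ → K) {x : K} (hx : x ≠ 0) (z : K) :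
    Qser a z = Qser (fun i => a i * x ^ i) (x⁻¹ * z) := by
  refine tsum_congr fun i => ?_
  rw [mul_assoc, ← mul_pow, mul_inv_cancel_left₀ hx]

theorem iteratedDeriv_comp_mul_left' (f : K → K) (c : K) (k : ℕ) :
    iteratedDeriv k (fun z => f (c * z)) = fun z => c ^ k * iteratedDeriv k f (c * z) := by
  induction k with
  | zero => simp
  | succ k ih =>
    ext z
    rw [iteratedDeriv_succ, ih, deriv_const_mul_field, deriv_comp_mul_left, iteratedDeriv_succ,
      smul_eq_mul, pow_succ, mul_assoc]

theorem zeroOrder_comp_mul_left (f : K → K) {c : K} (hc : c ≠ 0) (z : K) :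
    zeroOrder (fun z => f (c * z)) z = zeroOrder f (c * z) := by
  simp [zeroOrder, iteratedDeriv_comp_mul_left', hc]

end Rescaling

/-- Counting roots of a power series on a sphere.  Let `f(z) = Σ a_i z^i` with
`|a_i|·r^i → 0`, `r` in the value group.  Then `f` has a root of absolute value `r` iff
there are `n < m` with `|a_n|·r^n = |a_m|·r^m = sup_i |a_i|·r^i`; and if `n`, `m` are the
smallest and largest indices attaining the supremum, then `f` has exactly `m − n` roots of
absolute value `r`, counted with multiplicity.  Here `K` plays the role of `ℂ_p`. -/
theorem statement4 (p : ℕ) (hp : p.Prime)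
    {K : Type*} [NontriviallyNormedField K] [IsAlgClosed K] [CompleteSpace K]
    [IsUltrametricDist K] [CharZero K]
    (hpnorm : ‖(p : K)‖ = (p : ℝ)⁻¹)
    (a : ℕ → K) (r : ℝ) (hrval : ∃ x : K, x ≠ 0 ∧ ‖x‖ = r)
    (htend : Tendsto (fun i : ℕ => ‖a i‖ * r ^ i) atTop (nhds 0)) :
    -- existence of a root of absolute value `r`
    ((∃ α : K, ‖α‖ = r ∧ Qser a α = 0) ↔
      ∃ n m : ℕ, n < m ∧ ‖a n‖ * r ^ n = ‖a m‖ * r ^ m ∧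
        ∀ i : ℕ, ‖a i‖ * r ^ i ≤ ‖a n‖ * r ^ n) ∧
    -- the count of roots of absolute value `r`, with multiplicity
    (∀ n m : ℕ,
      (∀ i : ℕ, ‖a i‖ * r ^ i ≤ ‖a n‖ * r ^ n) →
      ‖a m‖ * r ^ m = ‖a n‖ * r ^ n →
      (∀ k : ℕ, ‖a k‖ * r ^ k = ‖a n‖ * r ^ n → n ≤ k ∧ k ≤ m) →
      ∃ T : Finset K, (∀ α : K, α ∈ T ↔ (‖α‖ = r ∧ Qser a α = 0)) ∧
        (∑ α ∈ T, zeroOrder (Qser a) α) = m - n) := by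
  classical
  obtain ⟨x, hx0, rfl⟩ := hrval
  set b : ℕ → K := fun i => a i * x ^ i with hb
  have hnorm : ∀ i, ‖a i‖ * ‖x‖ ^ i = ‖b i‖ := fun i => by rw [hb, norm_mul, norm_pow]
  simp only [hnorm] at htend ⊢
  have hb0 : Tendsto b atTop (nhds 0) := tendsto_zero_iff_norm_tendsto_zero.2 htend
  have hsphere : ∀ α : K, ‖α‖ = ‖x‖ ↔ ‖x⁻¹ * α‖ = 1 := fun α => by
    rw [norm_mul, norm_inv, inv_mul_eq_one₀ (norm_ne_zero_iff.2 hx0), eq_comm]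
  have hQ : Qser a = fun z => Qser b (x⁻¹ * z) := funext (Qser_eq_rescale a hx0)
  refine ⟨⟨?_, ?_⟩, fun n m hmax hm hext => ?_⟩
  · rintro ⟨α, hα, hroot⟩
    by_cases hz : ∀ i, b i = 0
    · exact ⟨0, 1, one_pos, by simp [hz], by simp [hz]⟩
    push Not at hz
    obtain ⟨j, hj⟩ := hz
    obtain ⟨n, m, M, h⟩ := exists_hasDominantRange hb0 hj
    refine ⟨n, m, h.left_le_right.lt_of_ne ?_, h.left.trans h.right.symm,
      fun i => (h.le i).trans_eq h.left.symm⟩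
    rintro rfl
    have hM := h.norm_Qser_eq hb0 ((hsphere α).1 hα)
    rw [hQ] at hroot
    exact h.pos.ne (by rw [← hM, show Qser b (x⁻¹ * α) = 0 from hroot, norm_zero])
  · rintro ⟨n, m, hnm, heq, hmax⟩
    by_cases hz : ∀ i, b i = 0
    · exact ⟨x, rfl, (tsum_congr hz).trans tsum_zero⟩
    push Not at hz
    obtain ⟨j, hj⟩ := hz
    obtain ⟨n', m', M, h⟩ := exists_hasDominantRange hb0 hj
    have hM : ‖b n‖ = M := (h.le n).antisymm (h.left ▸ hmax n')
    obtain ⟨β, hβ, hroot⟩ := h.exists_root hb0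
      ((h.le_of_norm_eq hM).1.trans_lt (hnm.trans_le (h.le_of_norm_eq (heq ▸ hM)).2))
    exact ⟨x * β, by rw [norm_mul, hβ, mul_one], by rw [hQ]; simpa [hx0] using hroot⟩
  · have hpos : 0 < ‖b n‖ := by
      refine (norm_nonneg _).lt_of_ne fun h0 => ?_
      have := (hext (m + 1) ((hmax _).antisymm (h0 ▸ norm_nonneg _))).2
      omega
    have h : HasDominantRange b n m ‖b n‖ := ⟨hpos, hmax, rfl, hm,
      fun i hi => (hmax i).lt_of_ne fun h => absurd (hext i h).1 (not_le.2 hi),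
      fun i hi => (hmax i).lt_of_ne fun h => absurd (hext i h).2 (not_le.2 hi)⟩
    obtain ⟨T, hT, hsum⟩ := exists_finset_roots_unit_sphere hb0 h
    refine ⟨T.image (x * ·), fun α => ?_, ?_⟩
    · rw [hsphere, hQ, ← hT, Finset.mem_image]
      constructor
      · rintro ⟨β, hβ, rfl⟩
        simpa [hx0] using hβ
      · exact fun hα => ⟨_, hα, mul_inv_cancel_left₀ hx0 α⟩
    · rw [Finset.sum_image (mul_right_injective₀ hx0).injOn, ← hsum, hQ]
      refine Finset.sum_congr rfl fun β _ => ?_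
      rw [zeroOrder_comp_mul_left _ (inv_ne_zero hx0), inv_mul_cancel_left₀ hx0]
end
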